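/- There exist positive constants c₁, c₂, c₃ with 0 < c₃ < 1, a constant C > 0, constants c > 0, and ε₀ > 0 such that for every ε ∈ (0, ε₀) and every v ∈ H¹(I), if either (θ₁(v) ≤ c₁ and θ₂(v) ≤ c₂) or inf_{|s| ≤ c₃·ρ} ‖v − τ_s Q_ε‖_{L²(I)} < c₃·√ε, then the function s ↦ ‖v − τ_s Q_ε‖_{L²(I)} has a unique global minimizer s* ∈ ℝ, and this minimizer satisfies s*² ≤ C·(ε² + θ₁(v)) and ‖v − τ_{s*} Q_ε‖²_{H¹_ε(I)} ≤ C·(θ₁(v) + e^{−c/ε}). -/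

import Mathlib

open MeasureTheory Real

/-- The truncated kink profile `Q_ε(z) = q_ε(z)·χ(z) + (1 − χ(z))·sign(z)`,
where `q_ε(z) = tanh(z/ε)`. -/
noncomputable def Qeps (χ : ℝ → ℝ) (ε z : ℝ) : ℝ :=
  Real.tanh (z / ε) * χ z + (1 - χ z) * Real.sign z

/-- `θ₁(v) := ∫_I (1+z²)((ε/2)v′² + (1/(2ε))(v²−1)²) dz − c₀`, with `c₀ = 4/3`. -/
noncomputable def theta1 (ρ ε : ℝ) (v : ℝ → ℝ) : ℝ :=
  (∫ z in Set.Ioo (-ρ) ρ,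
      (1 + z ^ 2) * ((ε / 2) * (deriv v z) ^ 2 + (1 / (2 * ε)) * ((v z) ^ 2 - 1) ^ 2))
    - 4 / 3

/-- `θ₂(v) := ∫_I |z|·|v(z) − sign(z)|² dz`. -/
noncomputable def theta2 (ρ : ℝ) (v : ℝ → ℝ) : ℝ :=
  ∫ z in Set.Ioo (-ρ) ρ, |z| * (v z - Real.sign z) ^ 2

/-- The `L²(I)` distance from `v` to the translate `τ_s Q_ε`. -/
noncomputable def L2distQ (ρ : ℝ) (χ : ℝ → ℝ) (ε : ℝ) (v : ℝ → ℝ) (s : ℝ) : ℝ :=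
  Real.sqrt (∫ z in Set.Ioo (-ρ) ρ, (v z - Qeps χ ε (z - s)) ^ 2)



/-! ### Elementary facts on tanh -/

lemma th_deriv (x : ℝ) : HasDerivAt Real.tanh (1 - Real.tanh x ^ 2) x := by
  have h1 := (Real.hasDerivAt_sinh x).div (Real.hasDerivAt_cosh x) (Real.cosh_pos x).ne'
  have h2 : Real.tanh = fun y => Real.sinh y / Real.cosh y := by
    funext y; exact Real.tanh_eq_sinh_div_cosh y
  have h3 : 1 - Real.tanh x ^ 2
      = (Real.cosh x * Real.cosh x - Real.sinh x * Real.sinh x) / Real.cosh x ^ 2 := by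
    rw [Real.tanh_eq_sinh_div_cosh]
    have := (Real.cosh_pos x).ne'
    field_simp
  rw [h3, h2]
  exact h1

lemma th_cont : Continuous Real.tanh :=
  continuous_iff_continuousAt.2 fun x => (th_deriv x).continuousAt

lemma th_diff (y h : ℝ) : Real.tanh (y + h) - Real.tanh y
    = Real.tanh h * (1 - Real.tanh y ^ 2) / (1 + Real.tanh y * Real.tanh h) := by
  have h0 := (Real.cosh_pos y).ne'
  have h1 := (Real.cosh_pos h).ne'
  have h2 := (Real.cosh_pos (y + h)).ne'
  have h3 := Real.cosh_sq y
  have h4 : 1 + Real.sinh y / Real.cosh y * (Real.sinh h / Real.cosh h)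
      = Real.cosh (y + h) / (Real.cosh y * Real.cosh h) := by
    rw [Real.cosh_add]; field_simp
  simp only [Real.tanh_eq_sinh_div_cosh]
  rw [h4]
  have h5 : 1 - (Real.sinh y / Real.cosh y) ^ 2 = 1 / Real.cosh y ^ 2 := by
    field_simp; linarith
  rw [h5]
  field_simp
  rw [Real.sinh_add, Real.cosh_add]
  have : Real.cosh y * (Real.cosh y * Real.sinh h) = (Real.sinh y ^ 2 + 1) * Real.sinh h := by
    rw [← h3]; ring
  nlinarith [this]

lemma th_one_sub_sq_pos (y : ℝ) : 0 < 1 - Real.tanh y ^ 2 := by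
  have := Real.tanh_sq_lt_one y; linarith

lemma th_strictMono : StrictMono Real.tanh :=
  strictMono_of_hasDerivAt_pos th_deriv th_one_sub_sq_pos

lemma th_nonneg {h : ℝ} (hh : 0 ≤ h) : 0 ≤ Real.tanh h := by
  have := th_strictMono.monotone hh; simpa using this

lemma th_le {h : ℝ} (hh : 0 ≤ h) : Real.tanh h ≤ h := by
  have hm : Monotone (fun x : ℝ => x - Real.tanh x) := by
    refine monotone_of_deriv_nonneg (fun x => ((hasDerivAt_id x).sub (th_deriv x)).differentiableAt) ?_
    intro x
    have := ((hasDerivAt_id x).sub (th_deriv x)).deriv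
    have h2 : deriv (fun x : ℝ => x - Real.tanh x) x = 1 - (1 - Real.tanh x ^ 2) := this
    rw [h2]; nlinarith [sq_nonneg (Real.tanh x)]
  have := hm hh
  simp at this; exact this

lemma th_abs (h : ℝ) : |Real.tanh h| = Real.tanh |h| := by
  rcases le_total 0 h with h0 | h0
  · rw [abs_of_nonneg h0, abs_of_nonneg (th_nonneg h0)]
  · rw [abs_of_nonpos h0, Real.tanh_neg, abs_of_nonpos]
    have := th_nonneg (h := -h) (by linarith)
    rw [Real.tanh_neg] at this; linarith

lemma th_abs_le (h : ℝ) : |Real.tanh h| ≤ |h| := by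
  rw [th_abs]; exact th_le (abs_nonneg h)

lemma th_sq_small {y : ℝ} (hy : |y| ≤ 1 / 2) : 3 / 4 ≤ 1 - Real.tanh y ^ 2 := by
  have h1 := (th_abs_le y).trans hy
  have := sq_abs (Real.tanh y)
  nlinarith [abs_nonneg (Real.tanh y)]

lemma th_ge {h : ℝ} (hh : 0 ≤ h) (h1 : h ≤ 1 / 2) : h / 2 ≤ Real.tanh h := by
  have hm : MonotoneOn (fun x : ℝ => Real.tanh x - x / 2) (Set.Icc 0 (1/2)) := by
    refine monotoneOn_of_deriv_nonneg (convex_Icc _ _) ?_ ?_ ?_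
    · exact (th_cont.sub (continuous_id.div_const 2)).continuousOn
    · intro x _
      exact ((th_deriv x).sub ((hasDerivAt_id x).div_const 2)).differentiableAt.differentiableWithinAt
    · intro x hx
      rw [interior_Icc] at hx
      have h2 : deriv (fun x : ℝ => Real.tanh x - x / 2) x = (1 - Real.tanh x ^ 2) - 1 / 2 :=
        ((th_deriv x).sub ((hasDerivAt_id x).div_const 2)).deriv
      rw [h2]
      have := th_sq_small (y := x) (by rw [abs_of_nonneg hx.1.le]; exact hx.2.le)
      linarith
  have := hm (Set.left_mem_Icc.2 (by norm_num)) ⟨hh, h1⟩ hh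
  simp at this; exact this

lemma th_prod_le {y h : ℝ} (hh : |h| ≤ 1 / 2) : |Real.tanh y * Real.tanh h| ≤ 1 / 2 := by
  rw [abs_mul]
  have h1 := (th_abs_le h).trans hh
  have h2 := (Real.abs_tanh_lt_one y).le
  nlinarith [abs_nonneg (Real.tanh y), abs_nonneg (Real.tanh h)]

lemma th_diff_le {y h : ℝ} (hh : |h| ≤ 1 / 2) :
    |Real.tanh (y + h) - Real.tanh y| ≤ 2 * |h| * (1 - Real.tanh y ^ 2) := by
  have h1 := abs_le.1 (th_prod_le (y := y) hh)
  have h2 := th_one_sub_sq_pos y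
  rw [th_diff, abs_div, abs_mul, abs_of_pos h2, abs_of_pos (by linarith : 0 < 1 + Real.tanh y * Real.tanh h)]
  rw [div_le_iff₀ (by linarith)]
  have h3 := th_abs_le h
  have h4 : |Real.tanh h| * (1 - Real.tanh y ^ 2) ≤ |h| * (1 - Real.tanh y ^ 2) := by gcongr
  have h5 : 0 ≤ |h| * (1 - Real.tanh y ^ 2) := by positivity
  nlinarith

lemma th_diff_ge {y h : ℝ} (h0 : 0 ≤ h) (hh : h ≤ 1 / 2) (hy : |y| ≤ 1 / 2) :
    h / 4 ≤ Real.tanh (y + h) - Real.tanh y := by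
  have h1 := abs_le.1 (th_prod_le (y := y) (h := h) (by rwa [abs_of_nonneg h0]))
  have h2 := th_sq_small hy
  rw [th_diff, le_div_iff₀ (by linarith)]
  have h3 := th_ge h0 hh
  nlinarith

lemma th_second {y h : ℝ} (hh : |h| ≤ 1 / 2) :
    |Real.tanh (y + h) + Real.tanh (y - h) - 2 * Real.tanh y| ≤ 3 * h ^ 2 * (1 - Real.tanh y ^ 2) := by
  have h1 := abs_le.1 (th_prod_le (y := y) hh)
  have h2 := th_one_sub_sq_pos y
  have e1 := th_diff y h
  have e2 := th_diff y (-h)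
  rw [Real.tanh_neg, ← sub_eq_add_neg] at e2
  have e3 : Real.tanh (y + h) + Real.tanh (y - h) - 2 * Real.tanh y
      = -(2 * Real.tanh y * Real.tanh h ^ 2 * (1 - Real.tanh y ^ 2)) / (1 - (Real.tanh y * Real.tanh h) ^ 2) := by
    have n1 : (1 + Real.tanh y * Real.tanh h) ≠ 0 := by linarith
    have n2 : (1 + Real.tanh y * -Real.tanh h) ≠ 0 := by linarith
    have n3 : (1 - (Real.tanh y * Real.tanh h) ^ 2) ≠ 0 := by nlinarith
    have : Real.tanh (y + h) + Real.tanh (y - h) - 2 * Real.tanh y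
      = (Real.tanh (y + h) - Real.tanh y) + (Real.tanh (y - h) - Real.tanh y) := by ring
    rw [this, e1, e2, div_add_div _ _ n1 n2, div_eq_div_iff (mul_ne_zero n1 n2) n3]
    ring
  have n3 : 3 / 4 ≤ (1 - (Real.tanh y * Real.tanh h) ^ 2) := by nlinarith
  rw [e3, abs_div, abs_neg, abs_mul, abs_mul, abs_mul, abs_of_pos h2, abs_of_pos (by linarith : 0 < (1 - (Real.tanh y * Real.tanh h) ^ 2)),
    div_le_iff₀ (by linarith), abs_two, abs_of_nonneg (sq_nonneg (Real.tanh h))]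
  have h3 : Real.tanh h ^ 2 ≤ h ^ 2 := sq_le_sq.2 (th_abs_le h)
  have h4 := (Real.abs_tanh_lt_one y).le
  have h5 : 2 * |Real.tanh y| * Real.tanh h ^ 2 * (1 - Real.tanh y ^ 2) ≤ 2 * 1 * h ^ 2 * (1 - Real.tanh y ^ 2) := by
    gcongr
  have h6 : 0 ≤ h ^ 2 * (1 - Real.tanh y ^ 2) := by positivity
  nlinarith

lemma th_one_sub (y : ℝ) : 1 - Real.tanh y ≤ 2 * Real.exp (-(2 * y)) := by
  rw [Real.tanh_eq]
  have h1 := Real.exp_pos y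
  have h2 := Real.exp_pos (-y)
  have h3 : Real.exp (-(2 * y)) * Real.exp y = Real.exp (-y) := by
    rw [← Real.exp_add]; congr 1; ring
  have h4 : 0 < Real.exp (-(2*y)) := Real.exp_pos _
  have : 1 - (Real.exp y - Real.exp (-y)) / (Real.exp y + Real.exp (-y))
      = 2 * Real.exp (-y) / (Real.exp y + Real.exp (-y)) := by field_simp; ring
  rw [this, div_le_iff₀ (by linarith)]
  nlinarith [mul_pos h4 h2]

/-! ### The truncated profile -/

/-- The exponentially small parameter. -/
noncomputable def etaE (ρ ε : ℝ) : ℝ := Real.exp (-(ρ / 4) / ε)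

lemma etaE_pos (ρ ε : ℝ) : 0 < etaE ρ ε := Real.exp_pos _

lemma tanh_far {ρ ε y : ℝ} (hε : 0 < ε) (hy : ρ / 4 ≤ y) :
    1 - Real.tanh (y / ε) ≤ 2 * etaE ρ ε ^ 2 := by
  refine (th_one_sub _).trans ?_
  unfold etaE
  rw [← Real.exp_nat_mul]
  have : -(2 * (y / ε)) ≤ ((2 : ℕ) : ℝ) * (-(ρ / 4) / ε) := by
    have : ρ / 4 / ε ≤ y / ε := by gcongr
    push_cast
    rw [neg_div]; linarith
  gcongr

lemma Q_eq_tanh {ρ : ℝ} {χ : ℝ → ℝ} (hχ1 : ∀ z, |z| ≤ ρ / 3 → χ z = 1) {ε z : ℝ} (hz : |z| ≤ ρ / 3) :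
    Qeps χ ε z = Real.tanh (z / ε) := by
  simp [Qeps, hχ1 z hz]

lemma Q_neg {χ : ℝ → ℝ} (hχe : ∀ z, χ (-z) = χ z) (ε z : ℝ) :
    Qeps χ ε (-z) = - Qeps χ ε z := by
  simp only [Qeps, hχe, neg_div, Real.tanh_neg]
  have : Real.sign (-z) = - Real.sign z := by
    rcases lt_trichotomy z 0 with h | h | h
    · rw [Real.sign_of_neg h, Real.sign_of_pos (by linarith)]; norm_num
    · simp [h]
    · rw [Real.sign_of_pos h, Real.sign_of_neg (by linarith)]
  rw [this]; ring

lemma Q_one {ρ : ℝ} (hρ : 0 < ρ) {χ : ℝ → ℝ} (hχ0 : ∀ z, 2 * ρ / 3 ≤ |z| → χ z = 0) {ε z : ℝ}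
    (hz : 2 * ρ / 3 ≤ z) : Qeps χ ε z = 1 := by
  have h0 : 0 < z := by linarith
  simp [Qeps, hχ0 z (by rwa [abs_of_pos h0]), Real.sign_of_pos h0]

lemma Q_neg_one {ρ : ℝ} (hρ : 0 < ρ) {χ : ℝ → ℝ} (hχ0 : ∀ z, 2 * ρ / 3 ≤ |z| → χ z = 0) {ε z : ℝ}
    (hz : z ≤ -(2 * ρ / 3)) : Qeps χ ε z = -1 := by
  have h0 : z < 0 := by linarith
  simp [Qeps, hχ0 z (by rw [abs_of_neg h0]; linarith), Real.sign_of_neg h0]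

/-- For `z > -ρ/3`, the profile is `tanh + (1-χ)(1 - tanh)`. -/
lemma Q_right {ρ : ℝ} {χ : ℝ → ℝ} (hχ1 : ∀ z, |z| ≤ ρ / 3 → χ z = 1) {ε z : ℝ}
    (hz : -(ρ / 3) ≤ z) :
    Qeps χ ε z = Real.tanh (z / ε) + (1 - χ z) * (1 - Real.tanh (z / ε)) := by
  rcases le_or_gt z 0 with h | h
  · have : |z| ≤ ρ / 3 := by rw [abs_of_nonpos h]; linarith
    rw [Q_eq_tanh hχ1 this, hχ1 z this]; ring
  · simp only [Qeps, Real.sign_of_pos h]; ring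

lemma Q_sub_tanh_pos {ρ : ℝ} {χ : ℝ → ℝ} (hχ1 : ∀ z, |z| ≤ ρ / 3 → χ z = 1)
    (hρ : 0 < ρ) (hχr : ∀ z, χ z ∈ Set.Icc (0 : ℝ) 1) {ε z : ℝ} (hε : 0 < ε) (h0 : 0 ≤ z) :
    |Qeps χ ε z - Real.tanh (z / ε)| ≤ 2 * etaE ρ ε ^ 2 := by
  rcases le_or_gt z (ρ / 3) with h | h
  · rw [Q_eq_tanh hχ1 (by rwa [abs_of_nonneg h0])]; simp; positivity
  · rw [Q_right hχ1 (by linarith), add_sub_cancel_left]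
    have h1 := tanh_far (ρ := ρ) hε (y := z) (by linarith)
    have h2 := Real.tanh_lt_one (z / ε)
    have h3 := hχr z
    rw [abs_of_nonneg (mul_nonneg (by linarith [h3.2]) (by linarith))]
    nlinarith [h3.1, h3.2]

lemma Q_sub_tanh {ρ : ℝ} {χ : ℝ → ℝ} (hχ1 : ∀ z, |z| ≤ ρ / 3 → χ z = 1)
    (hρ : 0 < ρ) (hχr : ∀ z, χ z ∈ Set.Icc (0 : ℝ) 1) (hχe : ∀ z, χ (-z) = χ z)
    {ε : ℝ} (hε : 0 < ε) (z : ℝ) :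
    |Qeps χ ε z - Real.tanh (z / ε)| ≤ 2 * etaE ρ ε ^ 2 := by
  rcases le_total 0 z with h | h
  · exact Q_sub_tanh_pos hχ1 hρ hχr hε h
  · have := Q_sub_tanh_pos hχ1 hρ hχr hε (z := -z) (by linarith)
    rw [Q_neg hχe, neg_div, Real.tanh_neg, ← neg_sub', abs_neg] at this
    exact this

lemma Q_abs_le {χ : ℝ → ℝ} (hχr : ∀ z, χ z ∈ Set.Icc (0 : ℝ) 1) (ε z : ℝ) : |Qeps χ ε z| ≤ 1 := by
  have h1 := (Real.abs_tanh_lt_one (z / ε)).le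
  have h2 : |Real.sign z| ≤ 1 := by
    rcases Real.sign_apply_eq z with h | h | h <;> rw [h] <;> norm_num
  have h3 := hχr z
  unfold Qeps
  rw [abs_le] at *
  constructor <;> nlinarith [h3.1, h3.2]

lemma Q_cont {ρ : ℝ} (hρ : 0 < ρ) {χ : ℝ → ℝ} (hχs : ContDiff ℝ (⊤ : ℕ∞) χ)
    (hχ1 : ∀ z, |z| ≤ ρ / 3 → χ z = 1) (ε : ℝ) : Continuous (Qeps χ ε) := by
  have : Qeps χ ε = fun z => Real.tanh (z / ε) * χ z + (1 - χ z) * max (-1) (min 1 (3 * z / ρ)) := by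
    funext z
    unfold Qeps
    rcases le_or_gt |z| (ρ / 3) with h | h
    · simp [hχ1 z h]
    · congr 2
      rcases lt_abs.1 h with h' | h'
      · have : 1 ≤ 3 * z / ρ := by rw [le_div_iff₀ hρ]; linarith
        rw [Real.sign_of_pos (by linarith), min_eq_left this, max_eq_right (by norm_num)]
      · have : 3 * z / ρ ≤ -1 := by rw [div_le_iff₀ hρ]; linarith
        rw [Real.sign_of_neg (by linarith), min_eq_right (by linarith), max_eq_left this]
  rw [this]
  have h1 := hχs.continuous
  have h2 := th_cont
  exact ((h2.comp (continuous_id.div_const ε)).mul h1).add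
    ((continuous_const.sub h1).mul (by fun_prop))

/-- Uniform bounds for the cut-off function. -/
lemma chi_bounds {ρ : ℝ} {χ : ℝ → ℝ} (hχs : ContDiff ℝ (⊤ : ℕ∞) χ)
    (hχ0 : ∀ z, 2 * ρ / 3 ≤ |z| → χ z = 0) :
    ∃ L > 0, (∀ z, |deriv χ z| ≤ L) ∧ (∀ z h, |χ (z + h) - χ z| ≤ L * |h|) ∧
      (∀ z h, |χ (z + h) + χ (z - h) - 2 * χ z| ≤ 2 * L * h ^ 2) := by
  have hc : HasCompactSupport χ := by
    refine HasCompactSupport.intro (isCompact_Icc (a := -(2 * ρ / 3)) (b := 2 * ρ / 3)) ?_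
    intro z hz
    apply hχ0
    by_contra hcon
    push Not at hcon
    exact hz ⟨(abs_lt.1 hcon).1.le, (abs_lt.1 hcon).2.le⟩
  have hd1 : ContDiff ℝ 1 (deriv χ) := by
    have : ContDiff ℝ (1 + 1) χ := hχs.of_le (by norm_cast)
    exact (contDiff_succ_iff_deriv.1 this).2.2
  have hd0 : Differentiable ℝ χ := hχs.differentiable (by simp)
  have hd1' : Differentiable ℝ (deriv χ) := hd1.differentiable (by norm_num)
  obtain ⟨L1, hL1⟩ := hc.deriv.exists_bound_of_continuous hd1.continuous
  obtain ⟨L2, hL2⟩ := hc.deriv.deriv.exists_bound_of_continuous (hd1.continuous_deriv le_rfl)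
  set L := max 1 (max L1 L2) with hL
  have hLL1 : ∀ z, ‖deriv χ z‖ ≤ L := fun z => (hL1 z).trans (by simp [hL])
  have hLL2 : ∀ z, ‖deriv (deriv χ) z‖ ≤ L := fun z => (hL2 z).trans (by simp [hL])
  have lip1 : ∀ x y, |deriv χ y - deriv χ x| ≤ L * |y - x| := fun x y =>
    convex_univ.norm_image_sub_le_of_norm_deriv_le (fun z _ => hd1' z) (fun z _ => hLL2 z) trivial trivial
  refine ⟨L, by simp [hL], hLL1, ?_, ?_⟩
  · intro z h
    have := convex_univ.norm_image_sub_le_of_norm_deriv_le (f := χ) (fun z _ => hd0 z)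
      (fun z _ => hLL1 z) (Set.mem_univ z) (Set.mem_univ (z + h))
    simpa using this
  · intro z h
    have hφ : ∀ t, HasDerivAt (fun t => χ (z + t) + χ (z - t)) (deriv χ (z + t) + -(deriv χ (z - t))) t := by
      intro t
      exact ((hd0 (z + t)).hasDerivAt.comp_const_add z t).add ((hd0 (z - t)).hasDerivAt.comp_const_sub z t)
    have hb : ∀ t ∈ Set.Icc (-|h|) |h|, ‖deriv χ (z + t) + -(deriv χ (z - t))‖ ≤ 2 * L * |h| := by
      intro t ht
      have h1 := lip1 (z - t) (z + t)
      have h2 : |z + t - (z - t)| = 2 * |t| := by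
        rw [show z + t - (z - t) = 2 * t by ring, abs_mul, abs_two]
      rw [h2] at h1
      rw [Real.norm_eq_abs, ← sub_eq_add_neg]
      have h3 : |t| ≤ |h| := abs_le.2 ht
      have : 0 < L := by simp [hL]
      nlinarith
    have := (convex_Icc (-|h|) |h|).norm_image_sub_le_of_norm_hasDerivWithin_le
      (fun t _ => (hφ t).hasDerivWithinAt) hb (x := 0) (y := h) ⟨by simp, by simp⟩
      ⟨neg_abs_le h, le_abs_self h⟩
    simp only [add_zero, sub_zero, Real.norm_eq_abs] at this
    rw [show χ (z + h) + χ (z - h) - 2 * χ z = χ (z + h) + χ (z - h) - (χ z + χ z) by ring]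
    refine this.trans (le_of_eq ?_)
    rw [mul_assoc, ← sq, sq_abs]

lemma tanh_div_deriv {ε : ℝ} (hε : 0 < ε) (z : ℝ) :
    HasDerivAt (fun z => Real.tanh (z / ε)) ((1 - Real.tanh (z / ε) ^ 2) / ε) z := by
  have := (th_deriv (z / ε)).comp z ((hasDerivAt_id z).div_const ε)
  simp only [Function.comp_def, id] at this
  rw [div_eq_mul_one_div]
  exact this

lemma Q_deriv {ρ : ℝ} (hρ : 0 < ρ) {χ : ℝ → ℝ} (hχs : ContDiff ℝ (⊤ : ℕ∞) χ)
    (hχe : ∀ z, χ (-z) = χ z) (hχr : ∀ z, χ z ∈ Set.Icc (0 : ℝ) 1)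
    (hχ1 : ∀ z, |z| ≤ ρ / 3 → χ z = 1) (hχ0 : ∀ z, 2 * ρ / 3 ≤ |z| → χ z = 0) :
    ∃ K > 0, ∀ ε, 0 < ε → ε ≤ 1 → ∀ z, ∃ d, HasDerivAt (Qeps χ ε) d z ∧
      |d - (1 - Real.tanh (z / ε) ^ 2) / ε| ≤ K / ε * etaE ρ ε ^ 2 := by
  obtain ⟨L, hL0, hL, -, -⟩ := chi_bounds hχs hχ0
  refine ⟨2 * L + 4, by positivity, ?_⟩
  intro ε hε hε1
  have hd0 : Differentiable ℝ χ := hχs.differentiable (by simp)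
  have key : ∀ z, 0 ≤ z → ∃ d, HasDerivAt (Qeps χ ε) d z ∧
      |d - (1 - Real.tanh (z / ε) ^ 2) / ε| ≤ (2 * L + 4) / ε * etaE ρ ε ^ 2 := by
    intro z hz
    have ht := tanh_div_deriv hε z
    have h1 : HasDerivAt (fun z => Real.tanh (z / ε) + (1 - χ z) * (1 - Real.tanh (z / ε)))
      ((1 - Real.tanh (z / ε) ^ 2) / ε + ((-deriv χ z) * (1 - Real.tanh (z / ε))
        + (1 - χ z) * (-((1 - Real.tanh (z / ε) ^ 2) / ε)))) z :=
      ht.add (((hd0 z).hasDerivAt.const_sub 1).mul (ht.const_sub 1))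
    refine ⟨_, h1.congr_of_eventuallyEq ?_, ?_⟩
    · have : Set.Ioi (-(ρ / 3)) ∈ nhds z := Ioi_mem_nhds (by linarith)
      filter_upwards [this] with y hy
      exact Q_right hχ1 (le_of_lt hy)
    · rw [add_sub_cancel_left]
      rcases lt_or_ge z (ρ / 3) with h | h
      · have e1 : χ z = 1 := hχ1 z (by rw [abs_of_nonneg hz]; exact h.le)
        have e2 : deriv χ z = 0 := by
          have : χ =ᶠ[nhds z] fun _ => 1 := by
            filter_upwards [Ioo_mem_nhds (show -(ρ / 3) < z by linarith) h] with y hy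
            exact hχ1 y (abs_le.2 ⟨hy.1.le, hy.2.le⟩)
          rw [this.deriv_eq]; simp
        rw [e1, e2]; simp; positivity
      · have g1 := tanh_far (ρ := ρ) hε (y := z) (by linarith)
        have g2 := Real.tanh_lt_one (z / ε)
        have g3 := hχr z
        have g4 := Real.neg_one_lt_tanh (z / ε)
        have a1 : |(-deriv χ z) * (1 - Real.tanh (z / ε))| ≤ L * (2 * etaE ρ ε ^ 2) := by
          rw [abs_mul, abs_neg, abs_of_nonneg (by linarith : 0 ≤ 1 - Real.tanh (z / ε))]
          exact mul_le_mul (hL z) g1 (by linarith) hL0.le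
        have a2 : |(1 - χ z) * (-((1 - Real.tanh (z / ε) ^ 2) / ε))| ≤ 1 * (4 * etaE ρ ε ^ 2 / ε) := by
          rw [abs_mul, abs_neg, abs_of_nonneg (by linarith [g3.2] : 0 ≤ 1 - χ z),
            abs_of_nonneg (div_nonneg (th_one_sub_sq_pos _).le hε.le)]
          refine mul_le_mul (by linarith [g3.1]) ?_ (div_nonneg (th_one_sub_sq_pos _).le hε.le) (by norm_num)
          gcongr
          nlinarith
        refine (abs_add_le _ _).trans ((add_le_add a1 a2).trans ?_)
        have : L * (2 * etaE ρ ε ^ 2) ≤ L * (2 * etaE ρ ε ^ 2) / ε := by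
          rw [le_div_iff₀ hε]
          have : 0 ≤ L * (2 * etaE ρ ε ^ 2) := by positivity
          nlinarith
        calc _ ≤ L * (2 * etaE ρ ε ^ 2) / ε + 1 * (4 * etaE ρ ε ^ 2 / ε) := by linarith
          _ = _ := by ring
  intro z
  rcases le_total 0 z with h | h
  · exact key z h
  · obtain ⟨d, hd, hd2⟩ := key (-z) (by linarith)
    refine ⟨d, ?_, ?_⟩
    · have h1 := (hd.scomp z (hasDerivAt_neg z)).neg
      have e : Qeps χ ε = -(Qeps χ ε ∘ Neg.neg) := by
        funext y; simp [Q_neg hχe]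
      rw [e]
      simpa using h1
    · rw [neg_div, Real.tanh_neg, neg_sq] at hd2
      exact hd2

lemma Q_second {ρ : ℝ} (hρ : 0 < ρ) {χ : ℝ → ℝ} (hχs : ContDiff ℝ (⊤ : ℕ∞) χ)
    (hχe : ∀ z, χ (-z) = χ z) (hχr : ∀ z, χ z ∈ Set.Icc (0 : ℝ) 1)
    (hχ1 : ∀ z, |z| ≤ ρ / 3 → χ z = 1) (hχ0 : ∀ z, 2 * ρ / 3 ≤ |z| → χ z = 0) :
    ∃ K > 0, ∀ ε, 0 < ε → ε ≤ 1 → ∀ h, |h| ≤ ρ / 12 → |h / ε| ≤ 1 / 2 → ∀ z,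
      |Qeps χ ε (z + h) + Qeps χ ε (z - h) - 2 * Qeps χ ε z|
        ≤ (h / ε) ^ 2 * (3 * (1 - Real.tanh (z / ε) ^ 2) + K * etaE ρ ε ^ 2) := by
  obtain ⟨L, hL0, hL, hL1, hL2⟩ := chi_bounds hχs hχ0
  refine ⟨12 + 20 * L, by positivity, ?_⟩
  intro ε hε hε1 h hh hh2
  have key : ∀ z, 0 ≤ z → |Qeps χ ε (z + h) + Qeps χ ε (z - h) - 2 * Qeps χ ε z|
        ≤ (h / ε) ^ 2 * (3 * (1 - Real.tanh (z / ε) ^ 2) + (12 + 20 * L) * etaE ρ ε ^ 2) := by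
    intro z hz
    have hhl := abs_le.1 hh
    rw [Q_right hχ1 (by linarith : -(ρ / 3) ≤ z + h), Q_right hχ1 (by linarith : -(ρ / 3) ≤ z - h),
      Q_right hχ1 (by linarith : -(ρ / 3) ≤ z)]
    have s1 := th_second (y := z / ε) hh2
    rw [← add_div, ← sub_div] at s1
    have p1 := th_one_sub_sq_pos (z / ε)
    rcases lt_or_ge z (ρ / 4) with hc | hc
    · rw [hχ1 (z + h) (abs_le.2 ⟨by linarith, by linarith⟩), hχ1 (z - h) (abs_le.2 ⟨by linarith, by linarith⟩),
        hχ1 z (abs_le.2 ⟨by linarith, by linarith⟩)]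
      simp only [sub_self, zero_mul, add_zero]
      refine s1.trans ?_
      have : 0 ≤ (h / ε) ^ 2 * ((12 + 20 * L) * etaE ρ ε ^ 2) := by positivity
      linarith
    · have g1 := tanh_far (ρ := ρ) hε (y := z) (by linarith)
      have g2 := Real.tanh_lt_one (z / ε)
      have g3 := hχr z
      have g4 := Real.neg_one_lt_tanh (z / ε)
      have g5 : 1 - Real.tanh (z / ε) ^ 2 ≤ 4 * etaE ρ ε ^ 2 := by nlinarith
      have d1 := th_diff_le (y := z / ε) hh2
      have d2 := th_diff_le (y := z / ε) (h := -(h / ε)) (by rwa [abs_neg])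
      rw [← sub_eq_add_neg, abs_neg, ← sub_div] at d2
      rw [← add_div] at d1
      have c1 := hL1 z h
      have c2 := hL1 z (-h)
      rw [← sub_eq_add_neg, abs_neg] at c2
      have c3 := hL2 z h
      have hhe : |h| ≤ |h / ε| := by
        rw [abs_div, abs_of_pos hε, le_div_iff₀ hε]
        nlinarith [abs_nonneg h]
      set k := |h / ε| with hk
      have hk0 : 0 ≤ k := abs_nonneg _
      have hk2 : (h / ε) ^ 2 = k ^ 2 := (sq_abs _).symm
      have hh2' : h ^ 2 ≤ k ^ 2 := by rw [← sq_abs h]; gcongr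
      set t := Real.tanh (z / ε)
      set tp := Real.tanh ((z + h) / ε)
      set tm := Real.tanh ((z - h) / ε)
      set m := etaE ρ ε ^ 2 with hm
      have hm0 : 0 < m := by have := etaE_pos ρ ε; positivity
      rw [hk2] at s1 ⊢
      have e : tp + (1 - χ (z + h)) * (1 - tp) + (tm + (1 - χ (z - h)) * (1 - tm)) - 2 * (t + (1 - χ z) * (1 - t))
        = (tp + tm - 2 * t) + (1 - χ z) * (-(tp + tm - 2 * t)) + (χ (z + h) - χ z) * (tp - t)
          + (χ (z - h) - χ z) * (tm - t) + (1 - t) * (-(χ (z + h) + χ (z - h) - 2 * χ z)) := by ring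
      have b2 : |(1 - χ z) * (-(tp + tm - 2 * t))| ≤ 1 * (3 * k ^ 2 * (4 * m)) := by
        rw [abs_mul, abs_neg]
        refine mul_le_mul (abs_le.2 ⟨by linarith [g3.2], by linarith [g3.1]⟩) (s1.trans (by gcongr)) (abs_nonneg _) (by norm_num)
      have b3 : |(χ (z + h) - χ z) * (tp - t)| ≤ (L * k) * (2 * k * (4 * m)) := by
        rw [abs_mul]
        exact mul_le_mul (c1.trans (by gcongr)) (d1.trans (by gcongr)) (abs_nonneg _) (by positivity)
      have b4 : |(χ (z - h) - χ z) * (tm - t)| ≤ (L * k) * (2 * k * (4 * m)) := by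
        rw [abs_mul]
        exact mul_le_mul (c2.trans (by gcongr)) (d2.trans (by gcongr)) (abs_nonneg _) (by positivity)
      have b5 : |(1 - t) * (-(χ (z + h) + χ (z - h) - 2 * χ z))| ≤ (2 * m) * (2 * L * k ^ 2) := by
        rw [abs_mul, abs_neg]
        refine mul_le_mul ?_ (c3.trans (by gcongr)) (abs_nonneg _) (by positivity)
        rw [abs_of_nonneg (by linarith)]; exact g1
      rw [e]
      refine (abs_add_le _ _).trans ?_
      have q1 := abs_add_le (tp + tm - 2 * t) ((1 - χ z) * (-(tp + tm - 2 * t)))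
      have q2 := abs_add_le ((tp + tm - 2 * t) + (1 - χ z) * (-(tp + tm - 2 * t))) ((χ (z + h) - χ z) * (tp - t))
      have q3 := abs_add_le ((tp + tm - 2 * t) + (1 - χ z) * (-(tp + tm - 2 * t)) + (χ (z + h) - χ z) * (tp - t))
        ((χ (z - h) - χ z) * (tm - t))
      nlinarith
  intro z
  rcases le_total 0 z with hz | hz
  · exact key z hz
  · have := key (-z) (by linarith)
    rw [show -z + h = -(z - h) by ring, show -z - h = -(z + h) by ring, Q_neg hχe, Q_neg hχe, Q_neg hχe,
      neg_div, Real.tanh_neg, neg_sq] at this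
    rw [← abs_neg]
    refine le_trans (le_of_eq ?_) this
    congr 1; ring

/-! ### Existence and uniqueness of the minimizing shift -/

/-- The squared `L²` distance. -/
noncomputable def FQ (ρ : ℝ) (χ : ℝ → ℝ) (ε : ℝ) (v : ℝ → ℝ) (s : ℝ) : ℝ :=
  ∫ z in Set.Ioo (-ρ) ρ, (v z - Qeps χ ε (z - s)) ^ 2

lemma FQ_nonneg (ρ : ℝ) (χ : ℝ → ℝ) (ε : ℝ) (v : ℝ → ℝ) (s : ℝ) : 0 ≤ FQ ρ χ ε v s :=
  integral_nonneg fun _ => sq_nonneg _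

lemma L2_le_iff (ρ : ℝ) (χ : ℝ → ℝ) (ε : ℝ) (v : ℝ → ℝ) (s σ : ℝ) :
    L2distQ ρ χ ε v s ≤ L2distQ ρ χ ε v σ ↔ FQ ρ χ ε v s ≤ FQ ρ χ ε v σ :=
  Real.sqrt_le_sqrt_iff (FQ_nonneg ρ χ ε v σ)

lemma int_lower {ρ c p l : ℝ} {f : ℝ → ℝ} (hf : IntegrableOn f (Set.Ioo (-ρ) ρ)) (h0 : ∀ z, 0 ≤ f z)
    (hl : 0 ≤ l) (hp : -ρ < p) (hp2 : p + l < ρ) (hc : ∀ z ∈ Set.Icc p (p + l), c ≤ f z) :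
    c * l ≤ ∫ z in Set.Ioo (-ρ) ρ, f z := by
  have hsub : Set.Icc p (p + l) ⊆ Set.Ioo (-ρ) ρ := fun z hz => ⟨by linarith [hz.1], by linarith [hz.2]⟩
  have h1 : ∫ z in Set.Icc p (p + l), f z ≤ ∫ z in Set.Ioo (-ρ) ρ, f z :=
    setIntegral_mono_set hf (Filter.Eventually.of_forall h0) hsub.eventuallyLE
  have h2 : ∫ z in Set.Icc p (p + l), c ≤ ∫ z in Set.Icc p (p + l), f z :=
    setIntegral_mono_on (integrableOn_const (by simp)) (hf.mono_set hsub) measurableSet_Icc hc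
  rw [setIntegral_const] at h2
  simp [hl] at h2
  linarith

lemma int_le4 {ρ : ℝ} (hρ : 0 < ρ) {f g1 g2 g3 g4 : ℝ → ℝ} (c1 c2 c3 c4 c : ℝ)
    (hf : IntegrableOn f (Set.Ioo (-ρ) ρ)) (h1 : IntegrableOn g1 (Set.Ioo (-ρ) ρ))
    (h2 : IntegrableOn g2 (Set.Ioo (-ρ) ρ)) (h3 : IntegrableOn g3 (Set.Ioo (-ρ) ρ))
    (h4 : IntegrableOn g4 (Set.Ioo (-ρ) ρ))
    (hle : ∀ z ∈ Set.Ioo (-ρ) ρ, f z ≤ c1 * g1 z + c2 * g2 z + c3 * g3 z + c4 * g4 z + c) :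
    ∫ z in Set.Ioo (-ρ) ρ, f z ≤ c1 * (∫ z in Set.Ioo (-ρ) ρ, g1 z) + c2 * (∫ z in Set.Ioo (-ρ) ρ, g2 z)
      + c3 * (∫ z in Set.Ioo (-ρ) ρ, g3 z) + c4 * (∫ z in Set.Ioo (-ρ) ρ, g4 z) + c * (2 * ρ) := by
  have j1 : IntegrableOn (fun z => c1 * g1 z) (Set.Ioo (-ρ) ρ) := Integrable.const_mul h1 c1
  have j2 : IntegrableOn (fun z => c2 * g2 z) (Set.Ioo (-ρ) ρ) := Integrable.const_mul h2 c2
  have j3 : IntegrableOn (fun z => c3 * g3 z) (Set.Ioo (-ρ) ρ) := Integrable.const_mul h3 c3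
  have j4 : IntegrableOn (fun z => c4 * g4 z) (Set.Ioo (-ρ) ρ) := Integrable.const_mul h4 c4
  have j12 : IntegrableOn (fun z => c1 * g1 z + c2 * g2 z) (Set.Ioo (-ρ) ρ) := Integrable.add j1 j2
  have j123 : IntegrableOn (fun z => c1 * g1 z + c2 * g2 z + c3 * g3 z) (Set.Ioo (-ρ) ρ) := Integrable.add j12 j3
  have j1234 : IntegrableOn (fun z => c1 * g1 z + c2 * g2 z + c3 * g3 z + c4 * g4 z) (Set.Ioo (-ρ) ρ) :=
    Integrable.add j123 j4
  have jc : IntegrableOn (fun _ : ℝ => c) (Set.Ioo (-ρ) ρ) := integrable_const c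
  have j : IntegrableOn (fun z => c1 * g1 z + c2 * g2 z + c3 * g3 z + c4 * g4 z + c) (Set.Ioo (-ρ) ρ) :=
    Integrable.add j1234 jc
  have e1 : (volume.restrict (Set.Ioo (-ρ) ρ)).real Set.univ = 2 * ρ := by
    simp [Measure.real, Real.volume_Ioo]; rw [ENNReal.toReal_ofReal (by linarith)]; ring
  refine (setIntegral_mono_on hf j measurableSet_Ioo hle).trans (le_of_eq ?_)
  rw [integral_add j1234 jc, integral_add j123 j4, integral_add j12 j3, integral_add j1 j2,
    integral_const_mul, integral_const_mul, integral_const_mul, integral_const_mul, integral_const, e1,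
    smul_eq_mul]
  ring

lemma int_sech {ρ ε : ℝ} (hρ : 0 < ρ) (hε : 0 < ε) (m : ℝ) :
    ∫ z in Set.Ioo (-ρ) ρ, (1 - Real.tanh ((z - m) / ε) ^ 2) ≤ 2 * ε := by
  rw [← integral_Ioc_eq_integral_Ioo, ← intervalIntegral.integral_of_le (by linarith)]
  have hc : Continuous fun z => 1 - Real.tanh ((z - m) / ε) ^ 2 :=
    continuous_const.sub ((th_cont.comp ((continuous_id.sub continuous_const).div_const ε)).pow 2)
  have hd : ∀ z ∈ Set.uIcc (-ρ) ρ, HasDerivAt (fun z => ε * Real.tanh ((z - m) / ε))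
      (1 - Real.tanh ((z - m) / ε) ^ 2) z := by
    intro z _
    have h1 := (th_deriv ((z - m) / ε)).comp z (((hasDerivAt_id z).sub_const m).div_const ε)
    have h2 := h1.const_mul ε
    simp only [Function.comp_def, id] at h2
    rw [show ε * ((1 - Real.tanh ((z - m) / ε) ^ 2) * (1 / ε)) = 1 - Real.tanh ((z - m) / ε) ^ 2 by
      field_simp] at h2
    exact h2
  rw [intervalIntegral.integral_eq_sub_of_hasDerivAt hd (hc.intervalIntegrable _ _)]
  have h1 := Real.tanh_lt_one ((ρ - m) / ε)
  have h2 := Real.neg_one_lt_tanh ((-ρ - m) / ε)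
  nlinarith

/-- Bounded continuous functions are square integrable on the interval. -/
lemma memLp_bdd {ρ M : ℝ} {g : ℝ → ℝ} (hg : Continuous g) (hb : ∀ z, |g z| ≤ M) :
    MemLp g 2 (volume.restrict (Set.Ioo (-ρ) ρ)) :=
  MemLp.of_bound hg.aestronglyMeasurable M (Filter.Eventually.of_forall hb)

lemma tq_cont (ε m : ℝ) : Continuous fun z => Real.tanh ((z - m) / ε) :=
  th_cont.comp ((continuous_id.sub continuous_const).div_const ε)

lemma tq_memLp (ρ ε m : ℝ) :
    MemLp (fun z => Real.tanh ((z - m) / ε)) 2 (volume.restrict (Set.Ioo (-ρ) ρ)) :=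
  memLp_bdd (tq_cont ε m) (fun _ => (Real.abs_tanh_lt_one _).le)

/-- The pointwise inequality behind the midpoint argument. -/
lemma midpoint_ineq {w a b M S k P : ℝ} (hS0 : 0 < S) (hS1 : S ≤ 1) (hk0 : 0 < k) (hk1 : k ≤ 1 / 200)
    (hx : |b + a - 2 * M| ≤ k ^ 2 * (3 * S + P)) :
    1 / 2 * (a - M) ^ 2 ≤ (1 + 2 * 9472 * k ^ 2) * (w - a) ^ 2 + 1 * (w - b) ^ 2
      + (-2) * (w - M) ^ 2 + k ^ 2 / 9472 * 18 * S + k ^ 2 / 9472 * (2 * P ^ 2) := by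
  set Y := b + a - 2 * M with hY
  have hx2 : Y ^ 2 ≤ (k ^ 2) ^ 2 * (18 * S + 2 * P ^ 2) := by
    have h1 : Y ^ 2 ≤ (k ^ 2 * (3 * S + P)) ^ 2 := by
      rw [← sq_abs Y]; exact pow_le_pow_left₀ (abs_nonneg _) hx 2
    have h2 : (3 * S + P) ^ 2 ≤ 18 * S + 2 * P ^ 2 := by
      nlinarith [sq_nonneg (3 * S - P)]
    rw [mul_pow] at h1
    exact h1.trans (by gcongr)
  have hk2 : 0 < k ^ 2 := by positivity
  have hk3 : k ^ 2 ≤ 1 / 40000 := by nlinarith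
  -- young
  have hy : 2 * (w - M) * Y ≤ 9472 * k ^ 2 * (w - M) ^ 2
      + k ^ 2 / 9472 * (18 * S + 2 * P ^ 2) := by
    have h1 : 2 * (w - M) * Y ≤ 9472 * k ^ 2 * (w - M) ^ 2 + Y ^ 2 / (9472 * k ^ 2) := by
      have : 9472 * k ^ 2 * (w - M) ^ 2 + Y ^ 2 / (9472 * k ^ 2) - 2 * (w - M) * Y
          = (9472 * k ^ 2 * (w - M) - Y) ^ 2 / (9472 * k ^ 2) := by
        field_simp; ring
      have h3 : 0 ≤ (9472 * k ^ 2 * (w - M) - Y) ^ 2 / (9472 * k ^ 2) := by positivity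
      linarith
    have h2 : Y ^ 2 / (9472 * k ^ 2) ≤ k ^ 2 / 9472 * (18 * S + 2 * P ^ 2) := by
      rw [div_le_iff₀ (by positivity)]
      calc _ ≤ _ := hx2
        _ = _ := by ring
    linarith
  have hvm : (w - M) ^ 2 ≤ 2 * (w - a) ^ 2 + 2 * (a - M) ^ 2 := by
    nlinarith [sq_nonneg ((w - a) - (a - M))]
  have hvm2 : 9472 * k ^ 2 * (w - M) ^ 2 ≤ 2 * 9472 * k ^ 2 * (w - a) ^ 2 + 1 / 2 * (a - M) ^ 2 := by
    have h1 : 9472 * k ^ 2 * (w - M) ^ 2 ≤ 9472 * k ^ 2 * (2 * (w - a) ^ 2 + 2 * (a - M) ^ 2) := by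
      gcongr
    have h2 : 9472 * k ^ 2 * (2 * (a - M) ^ 2) ≤ 1 / 2 * (a - M) ^ 2 := by
      nlinarith [sq_nonneg (a - M)]
    linarith
  have id : (w - a) ^ 2 + (w - b) ^ 2 - 2 * (w - M) ^ 2
      = (a - M) ^ 2 + (b - M) ^ 2 - 2 * (w - M) * Y := by rw [hY]; ring
  nlinarith [sq_nonneg (b - M)]

section
variable {ρ : ℝ} {χ : ℝ → ℝ}

lemma Q_memLp (hρ : 0 < ρ) (hχs : ContDiff ℝ (⊤ : ℕ∞) χ) (hχr : ∀ z, χ z ∈ Set.Icc (0 : ℝ) 1)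
    (hχ1 : ∀ z, |z| ≤ ρ / 3 → χ z = 1) (ε s : ℝ) :
    MemLp (fun z => Qeps χ ε (z - s)) 2 (volume.restrict (Set.Ioo (-ρ) ρ)) :=
  memLp_bdd ((Q_cont hρ hχs hχ1 ε).comp (continuous_id.sub continuous_const)) (fun _ => Q_abs_le hχr _ _)

lemma FQ_int (hρ : 0 < ρ) (hχs : ContDiff ℝ (⊤ : ℕ∞) χ) (hχr : ∀ z, χ z ∈ Set.Icc (0 : ℝ) 1)
    (hχ1 : ∀ z, |z| ≤ ρ / 3 → χ z = 1) (ε s : ℝ) {v : ℝ → ℝ}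
    (hv : MemLp v 2 (volume.restrict (Set.Ioo (-ρ) ρ))) :
    IntegrableOn (fun z => (v z - Qeps χ ε (z - s)) ^ 2) (Set.Ioo (-ρ) ρ) :=
  (hv.sub (Q_memLp hρ hχs hχr hχ1 ε s)).integrable_sq

lemma FQ_exists_min (hρ : 0 < ρ) (hχs : ContDiff ℝ (⊤ : ℕ∞) χ) (hχr : ∀ z, χ z ∈ Set.Icc (0 : ℝ) 1)
    (hχ1 : ∀ z, |z| ≤ ρ / 3 → χ z = 1) (hχ0 : ∀ z, 2 * ρ / 3 ≤ |z| → χ z = 0) (ε : ℝ) {v : ℝ → ℝ}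
    (hv : MemLp v 2 (volume.restrict (Set.Ioo (-ρ) ρ))) :
    ∃ s, ∀ σ, FQ ρ χ ε v s ≤ FQ ρ χ ε v σ := by
  have hcont : Continuous (FQ ρ χ ε v) := by
    unfold FQ
    refine continuous_of_dominated (bound := fun z => 2 * v z ^ 2 + 2) ?_ ?_ ?_ ?_
    · intro s
      exact ((hv.sub (Q_memLp hρ hχs hχr hχ1 ε s)).integrable_sq).aestronglyMeasurable
    · intro s
      refine Filter.Eventually.of_forall fun z => ?_
      have h1 := abs_le.1 (Q_abs_le hχr ε (z - s))
      rw [Real.norm_eq_abs, abs_of_nonneg (sq_nonneg _)]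
      nlinarith [sq_nonneg (v z + Qeps χ ε (z - s))]
    · exact (hv.integrable_sq.const_mul 2).add (integrable_const 2)
    · refine Filter.Eventually.of_forall fun z => ?_
      exact (continuous_const.sub ((Q_cont hρ hχs hχ1 ε).comp (continuous_const.sub continuous_id))).pow 2
  obtain ⟨s, hs, hmin⟩ := (isCompact_Icc (a := -(2 * ρ)) (b := 2 * ρ)).exists_isMinOn
    ⟨0, by constructor <;> linarith⟩ hcont.continuousOn
  refine ⟨s, fun σ => ?_⟩
  rcases lt_or_ge σ (-(2 * ρ)) with h | h
  · have : FQ ρ χ ε v σ = FQ ρ χ ε v (-(2 * ρ)) := by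
      refine setIntegral_congr_fun measurableSet_Ioo fun z hz => ?_
      beta_reduce
      rw [Q_one hρ hχ0 (by linarith [hz.1]), Q_one hρ hχ0 (by linarith [hz.1])]
    rw [this]; exact hmin ⟨le_rfl, by linarith⟩
  · rcases lt_or_ge (2 * ρ) σ with h' | h'
    · have : FQ ρ χ ε v σ = FQ ρ χ ε v (2 * ρ) := by
        refine setIntegral_congr_fun measurableSet_Ioo fun z hz => ?_
        beta_reduce
        rw [Q_neg_one hρ hχ0 (by linarith [hz.2]), Q_neg_one hρ hχ0 (by linarith [hz.2])]
      rw [this]; exact hmin ⟨by linarith, le_rfl⟩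
    · exact hmin ⟨h, h'⟩

lemma FQ_close (hρ : 0 < ρ) (hχs : ContDiff ℝ (⊤ : ℕ∞) χ) (hχe : ∀ z, χ (-z) = χ z)
    (hχr : ∀ z, χ z ∈ Set.Icc (0 : ℝ) 1)
    (hχ1 : ∀ z, |z| ≤ ρ / 3 → χ z = 1) {ε κ : ℝ} (hε : 0 < ε) (hε2 : ε ≤ ρ / 12)
    (hκ : 0 < κ) (hκ2 : κ ≤ 1 / 2)
    (hη : 64 * ρ * etaE ρ ε ^ 4 ≤ (κ / 20) ^ 2 * ε) {v : ℝ → ℝ}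
    (hv : MemLp v 2 (volume.restrict (Set.Ioo (-ρ) ρ))) {s₁ s : ℝ} (hs1 : |s₁| ≤ ρ / 4)
    (h1 : FQ ρ χ ε v s₁ ≤ (κ / 20) ^ 2 * ε) (h2 : FQ ρ χ ε v s ≤ (κ / 20) ^ 2 * ε) :
    |s - s₁| ≤ κ * ε := by
  have hs1' := abs_le.1 hs1
  set f : ℝ → ℝ := fun z => (Real.tanh ((z - s₁) / ε) - Real.tanh ((z - s) / ε)) ^ 2 with hf
  have hfi : IntegrableOn f (Set.Ioo (-ρ) ρ) := ((tq_memLp ρ ε s₁).sub (tq_memLp ρ ε s)).integrable_sq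
  have i1 := FQ_int hρ hχs hχr hχ1 ε s₁ hv
  have i2 := FQ_int hρ hχs hχr hχ1 ε s hv
  have hup : ∫ z in Set.Ioo (-ρ) ρ, f z ≤ 9 * ((κ / 20) ^ 2 * ε) := by
    have hle := int_le4 hρ (f := f) 4 4 0 0 (32 * etaE ρ ε ^ 4) hfi i1 i2 i1 i1 (fun z _ => by
      have a1 := Q_sub_tanh hχ1 hρ hχr hχe hε (z - s₁)
      have a2 := Q_sub_tanh hχ1 hρ hχr hχe hε (z - s)
      have a1' := sq_le_sq' (abs_le.1 a1).1 (abs_le.1 a1).2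
      have a2' := sq_le_sq' (abs_le.1 a2).1 (abs_le.1 a2).2
      simp only [hf]
      set A := v z - Qeps χ ε (z - s₁)
      set B := v z - Qeps χ ε (z - s) with hB
      set c := Qeps χ ε (z - s₁) - Real.tanh ((z - s₁) / ε)
      set d := Qeps χ ε (z - s) - Real.tanh ((z - s) / ε)
      have e : Real.tanh ((z - s₁) / ε) - Real.tanh ((z - s) / ε) = B - A + d - c := by
        simp only [A, B, c, d]; ring
      rw [e]
      nlinarith [sq_nonneg (A + B), sq_nonneg (B - d), sq_nonneg (B + c), sq_nonneg (A + d), sq_nonneg (A - c), sq_nonneg (d + c)])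
    unfold FQ at h1 h2
    linarith
  by_contra hcon
  push Not at hcon
  have hlow : (κ / 4) ^ 2 * (ε / 2) ≤ ∫ z in Set.Ioo (-ρ) ρ, f z := by
    rcases lt_abs.1 hcon with hc | hc
    · refine int_lower hfi (fun z => sq_nonneg _) (by linarith) (p := s₁) (by linarith) (by linarith) ?_
      intro z hz
      have hy0 : 0 ≤ (z - s₁) / ε := div_nonneg (by linarith [hz.1]) hε.le
      have hy1 : (z - s₁) / ε ≤ 1 / 2 := by rw [div_le_iff₀ hε]; linarith [hz.2]
      have g := th_diff_ge (y := (z - s₁) / ε - κ) hκ.le hκ2 (abs_le.2 ⟨by linarith, by linarith⟩)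
      rw [sub_add_cancel] at g
      have mo : Real.tanh ((z - s) / ε) ≤ Real.tanh ((z - s₁) / ε - κ) := by
        apply th_strictMono.monotone
        rw [div_le_iff₀ hε, sub_mul, div_mul_cancel₀ _ hε.ne']
        linarith
      simp only [hf]
      apply pow_le_pow_left₀ (by positivity)
      linarith
    · refine int_lower hfi (fun z => sq_nonneg _) (by linarith) (p := s₁ - ε / 2) (by linarith) (by linarith) ?_
      intro z hz
      have hy0 : (z - s₁) / ε ≤ 0 := div_nonpos_of_nonpos_of_nonneg (by linarith [hz.2]) hε.le
      have hy1 : -(1 / 2) ≤ (z - s₁) / ε := by rw [le_div_iff₀ hε]; linarith [hz.1]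
      have g := th_diff_ge (y := (z - s₁) / ε) hκ.le hκ2 (abs_le.2 ⟨by linarith, by linarith⟩)
      have mo : Real.tanh ((z - s₁) / ε + κ) ≤ Real.tanh ((z - s) / ε) := by
        apply th_strictMono.monotone
        rw [le_div_iff₀ hε, add_mul, div_mul_cancel₀ _ hε.ne']
        linarith
      simp only [hf]
      rw [← neg_sq (_ - _), neg_sub]
      apply pow_le_pow_left₀ (by positivity)
      linarith
  have : 0 < κ ^ 2 * ε := by positivity
  nlinarith

lemma FQ_unique (hρ : 0 < ρ) (hχs : ContDiff ℝ (⊤ : ℕ∞) χ) (hχe : ∀ z, χ (-z) = χ z)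
    (hχr : ∀ z, χ z ∈ Set.Icc (0 : ℝ) 1)
    (hχ1 : ∀ z, |z| ≤ ρ / 3 → χ z = 1) (hχ0 : ∀ z, 2 * ρ / 3 ≤ |z| → χ z = 0) :
    ∃ K > 0, ∀ ε, 0 < ε → ε ≤ 1 → ε ≤ ρ / 12 → 64 * ρ * etaE ρ ε ^ 4 ≤ (1 / 4000) ^ 2 * ε →
      4 * K ^ 2 * ρ * etaE ρ ε ^ 4 ≤ ε → ∀ v : ℝ → ℝ,
      MemLp v 2 (volume.restrict (Set.Ioo (-ρ) ρ)) → ∀ s₁, |s₁| ≤ ρ / 4 →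
      FQ ρ χ ε v s₁ ≤ (1 / 4000) ^ 2 * ε →
      ∃ s, (∀ σ, FQ ρ χ ε v s ≤ FQ ρ χ ε v σ) ∧
        (∀ s', (∀ σ, FQ ρ χ ε v s' ≤ FQ ρ χ ε v σ) → s' = s) ∧ |s - s₁| ≤ ε := by
  obtain ⟨K, hK0, hK⟩ := Q_second hρ hχs hχe hχr hχ1 hχ0
  refine ⟨K, hK0, ?_⟩
  intro ε hε hε1 hε2 hη1 hη2 v hv s₁ hs1 hF
  have close : ∀ s, FQ ρ χ ε v s ≤ (1 / 4000) ^ 2 * ε → |s - s₁| ≤ 1 / 200 * ε := by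
    intro s hs
    refine FQ_close hρ hχs hχe hχr hχ1 hε hε2 (by norm_num) (by norm_num) ?_ hv hs1 ?_ ?_ <;>
    norm_num at * <;> assumption
  have huniq : ∀ m h, 0 < h → (∀ σ, FQ ρ χ ε v (m + h) ≤ FQ ρ χ ε v σ) →
      (∀ σ, FQ ρ χ ε v (m - h) ≤ FQ ρ χ ε v σ) → False := by
    intro m h h0 hm1 hm2
    have cl1 := abs_le.1 (close _ ((hm1 s₁).trans hF))
    have cl2 := abs_le.1 (close _ ((hm2 s₁).trans hF))
    have hs1' := abs_le.1 hs1
    set k := h / ε with hk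
    have hk0 : 0 < k := by positivity
    have hk1 : k ≤ 1 / 200 := by rw [hk, div_le_iff₀ hε]; linarith
    have hkh : k * ε = h := by rw [hk]; field_simp
    have ia := FQ_int hρ hχs hχr hχ1 ε (m + h) hv
    have ib := FQ_int hρ hχs hχr hχ1 ε (m - h) hv
    have im := FQ_int hρ hχs hχr hχ1 ε m hv
    have iam : IntegrableOn (fun z => (Qeps χ ε (z - (m + h)) - Qeps χ ε (z - m)) ^ 2) (Set.Ioo (-ρ) ρ) :=
      FQ_int hρ hχs hχr hχ1 ε m (Q_memLp hρ hχs hχr hχ1 ε (m + h))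
    have iS : IntegrableOn (fun z => 1 - Real.tanh ((z - m) / ε) ^ 2) (Set.Ioo (-ρ) ρ) :=
      (integrable_const 1).sub (tq_memLp ρ ε m).integrable_sq
    -- the pointwise inequality
    have pt : ∀ z ∈ Set.Ioo (-ρ) ρ, 1 / 2 * (Qeps χ ε (z - (m + h)) - Qeps χ ε (z - m)) ^ 2 ≤
        (1 + 2 * 9472 * k ^ 2) * (v z - Qeps χ ε (z - (m + h))) ^ 2 + 1 * (v z - Qeps χ ε (z - (m - h))) ^ 2
          + (-2) * (v z - Qeps χ ε (z - m)) ^ 2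
          + k ^ 2 / 9472 * 18 * (1 - Real.tanh ((z - m) / ε) ^ 2)
          + k ^ 2 / 9472 * (2 * K ^ 2 * etaE ρ ε ^ 4) := by
      intro z _
      have hX2 := hK ε hε hε1 h (by rw [abs_of_pos h0]; linarith) (by rw [abs_of_pos hk0]; linarith) (z - m)
      rw [show z - m + h = z - (m - h) by ring, show z - m - h = z - (m + h) by ring] at hX2
      set a := Qeps χ ε (z - (m + h))
      set b := Qeps χ ε (z - (m - h))
      set M := Qeps χ ε (z - m)
      have hS0 := th_one_sub_sq_pos ((z - m) / ε)
      have hS1 : 1 - Real.tanh ((z - m) / ε) ^ 2 ≤ 1 := by nlinarith [sq_nonneg (Real.tanh ((z - m) / ε))]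
      set S := 1 - Real.tanh ((z - m) / ε) ^ 2
      have hx : |b + a - 2 * M| ≤ k ^ 2 * (3 * S + K * etaE ρ ε ^ 2) := hX2
      have := midpoint_ineq (w := v z) hS0 hS1 hk0 hk1 hx
      refine this.trans (le_of_eq ?_)
      ring
    have int1 := int_le4 hρ _ _ _ _ _ (Integrable.const_mul iam (1 / 2)) ia ib im iS pt
    rw [integral_const_mul] at int1
    have hS := int_sech hρ hε m
    have hlow : (k / 4) ^ 2 * (ε / 2) ≤ ∫ z in Set.Ioo (-ρ) ρ, (Qeps χ ε (z - (m + h)) - Qeps χ ε (z - m)) ^ 2 := by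
      refine int_lower iam (fun z => sq_nonneg _) (by linarith) (p := m) (by linarith) (by linarith) ?_
      intro z hz
      rw [Q_eq_tanh hχ1 (z := z - (m + h)) (abs_le.2 ⟨by linarith [hz.1], by linarith [hz.2]⟩),
        Q_eq_tanh hχ1 (z := z - m) (abs_le.2 ⟨by linarith [hz.1], by linarith [hz.2]⟩)]
      have hy0 : 0 ≤ (z - m) / ε := div_nonneg (by linarith [hz.1]) hε.le
      have hy1 : (z - m) / ε ≤ 1 / 2 := by rw [div_le_iff₀ hε]; linarith [hz.2]
      have g := th_diff_ge (y := (z - m) / ε - k) hk0.le (by linarith) (abs_le.2 ⟨by linarith, by linarith⟩)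
      rw [sub_add_cancel] at g
      have : (z - (m + h)) / ε = (z - m) / ε - k := by rw [hk]; ring
      rw [this, ← neg_sq (_ - _), neg_sub]
      exact pow_le_pow_left₀ (by positivity) g 2
    have hFa : FQ ρ χ ε v (m + h) ≤ (1 / 4000) ^ 2 * ε := (hm1 s₁).trans hF
    have hFam := hm1 m
    have hFbm := hm2 m
    have i1 : (∫ z in Set.Ioo (-ρ) ρ, (v z - Qeps χ ε (z - (m + h))) ^ 2) = FQ ρ χ ε v (m + h) := rfl
    have i2 : (∫ z in Set.Ioo (-ρ) ρ, (v z - Qeps χ ε (z - (m - h))) ^ 2) = FQ ρ χ ε v (m - h) := rfl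
    have i3 : (∫ z in Set.Ioo (-ρ) ρ, (v z - Qeps χ ε (z - m)) ^ 2) = FQ ρ χ ε v m := rfl
    rw [i1, i2, i3] at int1
    have hk2 : 0 < k ^ 2 := by positivity
    have t1 : 2 * 9472 * k ^ 2 * FQ ρ χ ε v (m + h) ≤ 2 * 9472 * k ^ 2 * ((1 / 4000) ^ 2 * ε) := by gcongr
    have t2 : k ^ 2 / 9472 * 18 * (∫ z in Set.Ioo (-ρ) ρ, (1 - Real.tanh ((z - m) / ε) ^ 2))
        ≤ k ^ 2 / 9472 * 18 * (2 * ε) := by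
      gcongr
    have t4 : k ^ 2 / 9472 * (2 * K ^ 2 * etaE ρ ε ^ 4) * (2 * ρ) ≤ k ^ 2 / 9472 * ε := by
      rw [mul_assoc (k ^ 2 / 9472)]
      gcongr
      linarith
    have t3 : 0 < k ^ 2 * ε := by positivity
    nlinarith
  obtain ⟨s, hs⟩ := FQ_exists_min hρ hχs hχr hχ1 hχ0 ε hv
  refine ⟨s, hs, ?_, ?_⟩
  · intro s' hs'
    by_contra hne
    rcases lt_or_gt_of_ne hne with hlt | hlt
    · refine huniq ((s + s') / 2) ((s - s') / 2) (by linarith) ?_ ?_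
      · rw [show (s + s') / 2 + (s - s') / 2 = s by ring]; exact hs
      · rw [show (s + s') / 2 - (s - s') / 2 = s' by ring]; exact hs'
    · refine huniq ((s + s') / 2) ((s' - s) / 2) (by linarith) ?_ ?_
      · rw [show (s + s') / 2 + (s' - s) / 2 = s' by ring]; exact hs'
      · rw [show (s + s') / 2 - (s' - s) / 2 = s by ring]; exact hs
  · have := close s ((hs s₁).trans hF)
    linarith

end

/-! ### Energy estimates -/

/-- Admissible functions. -/
def Adm (ρ : ℝ) (v : ℝ → ℝ) : Prop :=
  DifferentiableOn ℝ v (Set.Ioo (-ρ) ρ) ∧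
    IntegrableOn (fun z => (v z) ^ 2 + (deriv v z) ^ 2) (Set.Ioo (-ρ) ρ)

/-- The energy density. -/
noncomputable def en (ε : ℝ) (v : ℝ → ℝ) (z : ℝ) : ℝ :=
  (ε / 2) * (deriv v z) ^ 2 + (1 / (2 * ε)) * ((v z) ^ 2 - 1) ^ 2

/-- The first order defect. -/
noncomputable def rr (ε : ℝ) (v : ℝ → ℝ) (z : ℝ) : ℝ := ε * deriv v z - (1 - v z ^ 2)

/-- The primitive of `1 - t²`. -/
noncomputable def Gf (t : ℝ) : ℝ := t - t ^ 3 / 3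

lemma Gf_deriv (t : ℝ) : HasDerivAt Gf (1 - t ^ 2) t := by
  have h := (hasDerivAt_id t).sub (((hasDerivAt_id t).pow 3).div_const 3)
  have e : 1 - t ^ 2 = 1 - ((3 : ℕ) : ℝ) * id t ^ (3 - 1) * 1 / 3 := by
    simp
  rw [e]; exact h

lemma Adm.cont {ρ : ℝ} {v : ℝ → ℝ} (h : Adm ρ v) : ContinuousOn v (Set.Ioo (-ρ) ρ) := h.1.continuousOn

lemma Adm.hasDeriv {ρ : ℝ} {v : ℝ → ℝ} (h : Adm ρ v) {z : ℝ} (hz : z ∈ Set.Ioo (-ρ) ρ) :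
    HasDerivAt v (deriv v z) z :=
  ((h.1 z hz).differentiableAt (isOpen_Ioo.mem_nhds hz)).hasDerivAt

lemma Adm.aesm {ρ : ℝ} {v : ℝ → ℝ} (h : Adm ρ v) :
    AEStronglyMeasurable v (volume.restrict (Set.Ioo (-ρ) ρ)) :=
  h.cont.aestronglyMeasurable measurableSet_Ioo

lemma Adm.int_dsq {ρ : ℝ} {v : ℝ → ℝ} (h : Adm ρ v) :
    IntegrableOn (fun z => deriv v z ^ 2) (Set.Ioo (-ρ) ρ) := by
  refine Integrable.mono' h.2 ((measurable_deriv v).pow_const 2).aestronglyMeasurable ?_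
  refine Filter.Eventually.of_forall fun z => ?_
  rw [Real.norm_eq_abs, abs_of_nonneg (sq_nonneg _)]
  nlinarith [sq_nonneg (v z)]

lemma Adm.int_sq {ρ : ℝ} {v : ℝ → ℝ} (h : Adm ρ v) :
    IntegrableOn (fun z => v z ^ 2) (Set.Ioo (-ρ) ρ) := by
  refine Integrable.mono' h.2 (h.aesm.pow 2) ?_
  refine Filter.Eventually.of_forall fun z => ?_
  rw [Real.norm_eq_abs, abs_of_nonneg (sq_nonneg _)]
  nlinarith [sq_nonneg (deriv v z)]

lemma Adm.memLp {ρ : ℝ} {v : ℝ → ℝ} (h : Adm ρ v) :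
    MemLp v 2 (volume.restrict (Set.Ioo (-ρ) ρ)) :=
  (memLp_two_iff_integrable_sq h.aesm).2 h.int_sq

lemma Adm.int_d {ρ : ℝ} {v : ℝ → ℝ} (h : Adm ρ v) :
    IntegrableOn (deriv v) (Set.Ioo (-ρ) ρ) := by
  refine Integrable.mono' (g := fun z => 1 + deriv v z ^ 2) ((integrable_const 1).add h.int_dsq)
    (measurable_deriv v).aestronglyMeasurable ?_
  refine Filter.Eventually.of_forall fun z => ?_
  rw [Real.norm_eq_abs]
  nlinarith [sq_abs (deriv v z), sq_nonneg (|deriv v z| - 1)]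

lemma Adm.bdd {ρ : ℝ} {v : ℝ → ℝ} (h : Adm ρ v) (hρ : 0 < ρ) :
    ∃ B, ∀ z ∈ Set.Ioo (-ρ) ρ, |v z| ≤ B := by
  refine ⟨|v 0| + ∫ z in Set.Ioo (-ρ) ρ, |deriv v z|, fun z hz => ?_⟩
  have hsub : Set.uIcc 0 z ⊆ Set.Ioo (-ρ) ρ :=
    Set.OrdConnected.uIcc_subset Set.ordConnected_Ioo ⟨by linarith, hρ⟩ hz
  have hint : IntervalIntegrable (deriv v) volume 0 z :=
    (intervalIntegrable_iff.2 (h.int_d.mono_set (Set.uIoc_subset_uIcc.trans hsub)))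
  have := intervalIntegral.integral_eq_sub_of_hasDerivAt (fun y hy => h.hasDeriv (hsub hy)) hint
  have h2 : |∫ y in (0 : ℝ)..z, deriv v y| ≤ ∫ z in Set.Ioo (-ρ) ρ, |deriv v z| := by
    refine (intervalIntegral.norm_integral_le_integral_norm_uIoc (f := deriv v)).trans ?_
    exact setIntegral_mono_set (Integrable.abs h.int_d) (Filter.Eventually.of_forall fun _ => abs_nonneg _)
      (Set.uIoc_subset_uIcc.trans hsub).eventuallyLE
  rw [this] at h2
  have h3 : |v z| ≤ |v 0| + |v z - v 0| := by
    have := abs_add_le (v 0) (v z - v 0); rwa [add_sub_cancel] at this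
  linarith

/-- General integrability for admissible functions. -/
lemma Adm.int {ρ : ℝ} {v : ℝ → ℝ} (h : Adm ρ v) (hρ : 0 < ρ) {f : ℝ → ℝ} (g0 g1 g2 : ℝ × ℝ → ℝ)
    (c0 : Continuous g0) (c1 : Continuous g1) (c2 : Continuous g2)
    (hf : ∀ z, f z = g0 (z, v z) + g1 (z, v z) * deriv v z + g2 (z, v z) * deriv v z ^ 2) :
    IntegrableOn f (Set.Ioo (-ρ) ρ) := by
  obtain ⟨B, hB⟩ := h.bdd hρ
  have key : ∀ g : ℝ × ℝ → ℝ, Continuous g →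
      AEStronglyMeasurable (fun z => g (z, v z)) (volume.restrict (Set.Ioo (-ρ) ρ)) ∧
      ∃ M, ∀ᵐ z ∂(volume.restrict (Set.Ioo (-ρ) ρ)), ‖g (z, v z)‖ ≤ M := by
    intro g hg
    constructor
    · exact (hg.comp_continuousOn (continuousOn_id.prodMk h.cont)).aestronglyMeasurable measurableSet_Ioo
    · obtain ⟨M, hM⟩ := ((isCompact_Icc (a := -ρ) (b := ρ)).prod (isCompact_Icc (a := -B) (b := B))).exists_bound_of_continuousOn
        hg.continuousOn
      refine ⟨M, (ae_restrict_iff' measurableSet_Ioo).2 (Filter.Eventually.of_forall fun z hz => ?_)⟩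
      exact hM _ ⟨⟨hz.1.le, hz.2.le⟩, abs_le.1 (hB z hz)⟩
  obtain ⟨m0, M0, b0⟩ := key g0 c0
  obtain ⟨m1, M1, b1⟩ := key g1 c1
  obtain ⟨m2, M2, b2⟩ := key g2 c2
  have i0 : IntegrableOn (fun z => g0 (z, v z)) (Set.Ioo (-ρ) ρ) :=
    Integrable.of_bound m0 M0 b0
  have i1 : IntegrableOn (fun z => g1 (z, v z) * deriv v z) (Set.Ioo (-ρ) ρ) :=
    Integrable.bdd_mul h.int_d m1 b1
  have i2 : IntegrableOn (fun z => g2 (z, v z) * deriv v z ^ 2) (Set.Ioo (-ρ) ρ) :=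
    Integrable.bdd_mul h.int_dsq m2 b2
  have : f = fun z => g0 (z, v z) + g1 (z, v z) * deriv v z + g2 (z, v z) * deriv v z ^ 2 := funext hf
  rw [this]
  exact (Integrable.add i0 i1).add i2

lemma ii_of {ρ x y : ℝ} {f : ℝ → ℝ} (hf : IntegrableOn f (Set.Ioo (-ρ) ρ)) (hx : -ρ ≤ x) (hxy : x ≤ y)
    (hy : y ≤ ρ) : IntervalIntegrable f volume x y :=
  (intervalIntegrable_iff_integrableOn_Ioo_of_le hxy).2 (hf.mono_set (Set.Ioo_subset_Ioo hx hy))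

lemma ii_mono {x y : ℝ} {f g : ℝ → ℝ} (hxy : x ≤ y) (hf : IntervalIntegrable f volume x y)
    (hg : IntervalIntegrable g volume x y) (h : ∀ z ∈ Set.Ioo x y, f z ≤ g z) :
    ∫ z in x..y, f z ≤ ∫ z in x..y, g z :=
  intervalIntegral.integral_mono_on_of_le_Ioo hxy hf hg h

lemma Adm.int_en {ρ : ℝ} {v : ℝ → ℝ} (h : Adm ρ v) (hρ : 0 < ρ) (ε : ℝ) :
    IntegrableOn (en ε v) (Set.Ioo (-ρ) ρ) :=
  h.int hρ (fun p => (1 / (2 * ε)) * (p.2 ^ 2 - 1) ^ 2) (fun _ => 0) (fun _ => ε / 2)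
    (by fun_prop) (by fun_prop) (by fun_prop) (fun z => by simp only [en]; ring)

lemma Adm.int_zen {ρ : ℝ} {v : ℝ → ℝ} (h : Adm ρ v) (hρ : 0 < ρ) (ε : ℝ) :
    IntegrableOn (fun z => z ^ 2 * en ε v z) (Set.Ioo (-ρ) ρ) :=
  h.int hρ (fun p => p.1 ^ 2 * ((1 / (2 * ε)) * (p.2 ^ 2 - 1) ^ 2)) (fun _ => 0) (fun p => p.1 ^ 2 * (ε / 2))
    (by fun_prop) (by fun_prop) (by fun_prop) (fun z => by simp only [en]; ring)

lemma Adm.int_rr {ρ : ℝ} {v : ℝ → ℝ} (h : Adm ρ v) (hρ : 0 < ρ) (ε : ℝ) :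
    IntegrableOn (fun z => rr ε v z ^ 2) (Set.Ioo (-ρ) ρ) :=
  h.int hρ (fun p => (1 - p.2 ^ 2) ^ 2) (fun p => -(2 * ε * (1 - p.2 ^ 2))) (fun _ => ε ^ 2)
    (by fun_prop) (by fun_prop) (by fun_prop) (fun z => by simp only [rr]; ring)

lemma Adm.int_G {ρ : ℝ} {v : ℝ → ℝ} (h : Adm ρ v) (hρ : 0 < ρ) :
    IntegrableOn (fun z => (1 - v z ^ 2) * deriv v z) (Set.Ioo (-ρ) ρ) :=
  h.int hρ (fun _ => 0) (fun p => 1 - p.2 ^ 2) (fun _ => 0)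
    (by fun_prop) (by fun_prop) (by fun_prop) (fun z => by ring)

lemma Adm.ftcG {ρ : ℝ} {v : ℝ → ℝ} (h : Adm ρ v) (hρ : 0 < ρ) {x y : ℝ} (hx : -ρ < x) (hxy : x ≤ y) (hy : y < ρ) :
    ∫ z in x..y, (1 - v z ^ 2) * deriv v z = Gf (v y) - Gf (v x) := by
  refine intervalIntegral.integral_eq_sub_of_hasDerivAt (f := fun z => Gf (v z)) (fun z hz => ?_)
    (ii_of (h.int_G hρ) hx.le hxy hy.le)
  rw [Set.uIcc_of_le hxy] at hz
  exact (Gf_deriv (v z)).comp z (h.hasDeriv ⟨by linarith [hz.1], by linarith [hz.2]⟩)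

lemma en_nonneg {ε : ℝ} (hε : 0 < ε) (v : ℝ → ℝ) (z : ℝ) : 0 ≤ en ε v z := by
  unfold en; positivity

lemma en_eq {ε : ℝ} (hε : 0 < ε) (v : ℝ → ℝ) (z : ℝ) :
    en ε v z = 1 / (2 * ε) * rr ε v z ^ 2 + (1 - v z ^ 2) * deriv v z := by
  unfold en rr; field_simp; ring

lemma en_ge_pos {ε : ℝ} (hε : 0 < ε) (v : ℝ → ℝ) (z : ℝ) :
    (1 - v z ^ 2) * deriv v z ≤ en ε v z := by
  rw [en_eq hε]
  have : 0 ≤ 1 / (2 * ε) * rr ε v z ^ 2 := by positivity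
  linarith

lemma en_ge_neg {ε : ℝ} (hε : 0 < ε) (v : ℝ → ℝ) (z : ℝ) :
    -((1 - v z ^ 2) * deriv v z) ≤ en ε v z := by
  have e : en ε v z = 1 / (2 * ε) * (ε * deriv v z + (1 - v z ^ 2)) ^ 2 - (1 - v z ^ 2) * deriv v z := by
    unfold en; field_simp; ring
  have : 0 ≤ 1 / (2 * ε) * (ε * deriv v z + (1 - v z ^ 2)) ^ 2 := by positivity
  linarith

lemma rr_le_en {ε : ℝ} (hε : 0 < ε) (v : ℝ → ℝ) (z : ℝ) : rr ε v z ^ 2 ≤ 4 * ε * en ε v z := by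
  have h1 := en_ge_neg hε v z
  have h2 := en_eq hε v z
  have h3 : rr ε v z ^ 2 = 2 * ε * (1 / (2 * ε) * rr ε v z ^ 2) := by field_simp
  rw [h3]
  nlinarith

lemma W_le_en {ε : ℝ} (hε : 0 < ε) (v : ℝ → ℝ) (z : ℝ) : (v z ^ 2 - 1) ^ 2 ≤ 2 * ε * en ε v z := by
  have h1 : 2 * ε * en ε v z = ε ^ 2 * deriv v z ^ 2 + (v z ^ 2 - 1) ^ 2 := by
    unfold en; field_simp
  rw [h1]
  nlinarith [sq_nonneg (ε * deriv v z)]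

lemma rr_ge {ε : ℝ} (v : ℝ → ℝ) (z : ℝ) :
    -(4 * ε) * ((1 - v z ^ 2) * deriv v z) ≤ rr ε v z ^ 2 := by
  unfold rr; nlinarith [sq_nonneg (ε * deriv v z + (1 - v z ^ 2))]

lemma Adm.G_ge_en {ρ : ℝ} {v : ℝ → ℝ} (h : Adm ρ v) (hρ : 0 < ρ) {ε : ℝ} (hε : 0 < ε) {x y : ℝ}
    (hx : -ρ < x) (hxy : x ≤ y) (hy : y < ρ) :
    Gf (v x) - (∫ z in x..y, en ε v z) ≤ Gf (v y) := by
  have h1 := h.ftcG hρ hx hxy hy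
  have h2 := ii_mono hxy (ii_of (h.int_G hρ) hx.le hxy hy.le).neg (ii_of (h.int_en hρ ε) hx.le hxy hy.le)
    (fun z _ => en_ge_neg hε v z)
  have h3 : ∫ z in x..y, (-(fun z => (1 - v z ^ 2) * deriv v z)) z = -∫ z in x..y, (1 - v z ^ 2) * deriv v z :=
    intervalIntegral.integral_neg
  rw [h3] at h2
  linarith

lemma Adm.G_ge_rr {ρ : ℝ} {v : ℝ → ℝ} (h : Adm ρ v) (hρ : 0 < ρ) {ε : ℝ} (hε : 0 < ε) {x y : ℝ}
    (hx : -ρ < x) (hxy : x ≤ y) (hy : y < ρ) :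
    Gf (v x) - (1 / (4 * ε)) * (∫ z in x..y, rr ε v z ^ 2) ≤ Gf (v y) := by
  have h1 := h.ftcG hρ hx hxy hy
  have h2 := ii_mono hxy ((ii_of (h.int_G hρ) hx.le hxy hy.le).const_mul (-(4 * ε))) (ii_of (h.int_rr hρ ε) hx.le hxy hy.le)
    (fun z _ => rr_ge v z)
  rw [intervalIntegral.integral_const_mul, h1] at h2
  have h3 : (1 / (4 * ε)) * (-(4 * ε) * (Gf (v y) - Gf (v x))) ≤ (1 / (4 * ε)) * (∫ z in x..y, rr ε v z ^ 2) := by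
    gcongr
  have h4 : (1 / (4 * ε)) * (-(4 * ε) * (Gf (v y) - Gf (v x))) = -(Gf (v y) - Gf (v x)) := by field_simp
  linarith

/-- A continuity trap. -/
lemma trap {f : ℝ → ℝ} {x y α β : ℝ} (hxy : x ≤ y) (hf : ContinuousOn f (Set.Icc x y))
    (h0 : α < f x) (h1 : f x < β) (hne : ∀ z ∈ Set.Icc x y, f z ≠ α ∧ f z ≠ β) :
    α < f y ∧ f y < β := by
  constructor
  · by_contra hc
    push Not at hc
    obtain ⟨z, hz, hz2⟩ := intermediate_value_Icc' hxy hf ⟨hc, h0.le⟩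
    exact (hne z hz).1 hz2
  · by_contra hc
    push Not at hc
    obtain ⟨z, hz, hz2⟩ := intermediate_value_Icc hxy hf ⟨h1.le, hc⟩
    exact (hne z hz).2 hz2

/-- Reflection preserves admissibility. -/
lemma refl_deriv (v : ℝ → ℝ) (z : ℝ) : deriv (fun z => -v (-z)) z = deriv v (-z) := by
  have h : deriv (fun z => v (-z)) z = -deriv v (-z) := deriv_comp_neg v z
  have h2 : deriv (fun z => -v (-z)) z = -deriv (fun z => v (-z)) z :=
    deriv.fun_neg
  rw [h2, h, neg_neg]

lemma Adm.refl {ρ : ℝ} {v : ℝ → ℝ} (h : Adm ρ v) : Adm ρ (fun z => -v (-z)) := by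
  constructor
  · intro z hz
    have hz' : -z ∈ Set.Ioo (-ρ) ρ := ⟨by linarith [hz.2], by linarith [hz.1]⟩
    exact ((h.hasDeriv hz').scomp z (hasDerivAt_neg z)).neg.differentiableAt.differentiableWithinAt
  · have h1 := h.2
    have h2 : IntegrableOn (fun z => (fun z => (v z) ^ 2 + (deriv v z) ^ 2) (-z)) (Set.Ioo (-ρ) ρ) := by
      have := (Measure.measurePreserving_neg (volume : Measure ℝ)).integrableOn_comp_preimage
        (MeasurableEquiv.neg ℝ).measurableEmbedding (f := (fun z => (v z) ^ 2 + (deriv v z) ^ 2)) (s := Set.Ioo (-ρ) ρ)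
      have e : (Neg.neg ⁻¹' Set.Ioo (-ρ) ρ : Set ℝ) = Set.Ioo (-ρ) ρ := by
        ext z; simp only [Set.mem_preimage, Set.mem_Ioo]; constructor <;> intro h <;> constructor <;> linarith [h.1, h.2]
      rw [e] at this
      exact this.2 h1
    refine h2.congr_fun (fun z _ => ?_) measurableSet_Ioo
    simp only [refl_deriv, neg_sq]

lemma refl_en (ε : ℝ) (v : ℝ → ℝ) (z : ℝ) : en ε (fun z => -v (-z)) z = en ε v (-z) := by
  simp only [en, refl_deriv, neg_sq]

lemma refl_rr (ε : ℝ) (v : ℝ → ℝ) (z : ℝ) : rr ε (fun z => -v (-z)) z = rr ε v (-z) := by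
  simp only [rr, refl_deriv, neg_sq]

lemma Gf_neg (t : ℝ) : Gf (-t) = -Gf t := by unfold Gf; ring
lemma Adm.trap_right {ρ : ℝ} {v : ℝ → ℝ} (h : Adm ρ v) (hρ : 0 < ρ) {ε T : ℝ} (hε : 0 < ε) {s b : ℝ}
    (hs : -ρ < s) (hb : b < ρ) (h0 : v s = 0) (hT : T ≤ 1 / 10)
    (hR : ∫ z in s..b, rr ε v z ^ 2 ≤ 2 * ε * T) :
    ∀ z ∈ Set.Icc s b, -(1 / 4) < v z ∧ v z < 2 := by
  intro z hz
  refine trap hz.1 (h.cont.mono fun y hy => ⟨by linarith [hy.1], by linarith [hy.2, hz.2]⟩)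
    (by rw [h0]; norm_num) (by rw [h0]; norm_num) ?_
  intro y hy
  have hyb : y ≤ b := hy.2.trans hz.2
  have h1 := h.G_ge_rr hρ hε hs hy.1 (by linarith)
  have h2 : ∫ z in s..y, rr ε v z ^ 2 ≤ ∫ z in s..b, rr ε v z ^ 2 := by
    refine intervalIntegral.integral_mono_interval le_rfl hy.1 hyb
      (Filter.Eventually.of_forall fun z => sq_nonneg _) (ii_of (h.int_rr hρ ε) hs.le (hz.1.trans hz.2) hb.le)
  have h3 : (1 / (4 * ε)) * (∫ z in s..y, rr ε v z ^ 2) ≤ (1 / (4 * ε)) * (2 * ε * T) := by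
    gcongr; linarith
  have h4 : (1 / (4 * ε)) * (2 * ε * T) = T / 2 := by field_simp; norm_num
  have h5 : Gf (v s) = 0 := by rw [h0]; unfold Gf; norm_num
  constructor
  · intro hv
    rw [hv, h5] at h1
    unfold Gf at h1
    linarith
  · intro hv
    rw [hv, h5] at h1
    unfold Gf at h1
    linarith

lemma ode_pt {ε v d q m r : ℝ} (hε : 0 < ε) (hv : -(1 / 4) < v) (hq0 : 0 ≤ q) (hm : m * (1 + q) = 2)
    (hm1 : 1 ≤ m) (hm2 : m ≤ 2) (hr : r = ε * d - (1 - v ^ 2)) :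
    -(2 * (m - 1) / ε) * (v - q) ^ 2 + m * (2 * (v - q) * (d - (1 - q ^ 2) / ε))
      ≤ -(1 / (2 * ε)) * (v - q) ^ 2 + 8 / ε * r ^ 2 := by
  have hd : d = (r + (1 - v ^ 2)) / ε := by rw [hr]; field_simp; ring
  have e : -(2 * (m - 1) / ε) * (v - q) ^ 2 + m * (2 * (v - q) * (d - (1 - q ^ 2) / ε))
      = (1 / ε) * (-(2 * (m - 1)) * (v - q) ^ 2 - 2 * m * (v + q) * (v - q) ^ 2 + 2 * m * (v - q) * r) := by
    rw [hd]; field_simp; ring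
  have e2 : -(1 / (2 * ε)) * (v - q) ^ 2 + 8 / ε * r ^ 2 = (1 / ε) * (-(1 / 2) * (v - q) ^ 2 + 8 * r ^ 2) := by
    field_simp
  rw [e, e2]
  refine mul_le_mul_of_nonneg_left ?_ (by positivity)
  have hc : -(2 * (m - 1)) - 2 * m * (v + q) ≤ -1 := by nlinarith
  have h1 := mul_le_mul_of_nonneg_right hc (sq_nonneg (v - q))
  have h2 : 2 * m * (v - q) * r ≤ 1 / 2 * (v - q) ^ 2 + 2 * m ^ 2 * r ^ 2 := by
    nlinarith [sq_nonneg (v - q - 2 * m * r)]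
  have h3 : m ^ 2 * r ^ 2 ≤ 4 * r ^ 2 := by
    refine mul_le_mul_of_nonneg_right ?_ (sq_nonneg r); nlinarith
  nlinarith

lemma Adm.ode_right {ρ : ℝ} {v : ℝ → ℝ} (h : Adm ρ v) (hρ : 0 < ρ) {ε : ℝ} (hε : 0 < ε) {s b : ℝ}
    (hs : -ρ < s) (hsb : s ≤ b) (hb : b < ρ) (h0 : v s = 0)
    (hv : ∀ z ∈ Set.Icc s b, -(1 / 4) < v z) :
    ∫ z in s..b, (v z - Real.tanh ((z - s) / ε)) ^ 2 ≤ 16 * ∫ z in s..b, rr ε v z ^ 2 := by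
  set q : ℝ → ℝ := fun z => Real.tanh ((z - s) / ε) with hq
  have hqc : Continuous q := tq_cont ε s
  have hq1 : ∀ z, 0 < 1 + q z := fun z => by linarith [(abs_lt.1 (Real.abs_tanh_lt_one ((z - s) / ε))).1]
  have hqd : ∀ z, HasDerivAt q ((1 - q z ^ 2) / ε) z := by
    intro z
    have := (tanh_div_deriv hε (z - s)).comp z ((hasDerivAt_id z).sub_const s)
    rw [mul_one] at this; exact this
  set m : ℝ → ℝ := fun z => 2 / (1 + q z) with hm
  have hmc : Continuous m := continuous_const.div (continuous_const.add hqc) (fun z => (hq1 z).ne')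
  have hmd : ∀ z, HasDerivAt m (-(2 * (m z - 1) / ε)) z := by
    intro z
    have h1 := (hasDerivAt_const z (2 : ℝ)).div ((hqd z).const_add 1) (hq1 z).ne'
    have e : -(2 * (m z - 1) / ε) = (0 * (1 + q z) - 2 * ((1 - q z ^ 2) / ε)) / (1 + q z) ^ 2 := by
      simp only [hm]
      have := (hq1 z).ne'
      field_simp
      ring
    rw [e]; exact h1
  set φ' : ℝ → ℝ := fun z => -(2 * (m z - 1) / ε) * (v z - q z) ^ 2
    + m z * (2 * (v z - q z) * (deriv v z - (1 - q z ^ 2) / ε)) with hφ'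
  have hφi : IntegrableOn φ' (Set.Ioo (-ρ) ρ) := by
    refine h.int hρ (fun p => -(2 * (m p.1 - 1) / ε) * (p.2 - q p.1) ^ 2
      + m p.1 * (2 * (p.2 - q p.1) * (- ((1 - q p.1 ^ 2) / ε)))) (fun p => m p.1 * (2 * (p.2 - q p.1))) (fun _ => 0)
      (by fun_prop) (by fun_prop) (by fun_prop) (fun z => by simp only [hφ']; ring)
  have hw : IntegrableOn (fun z => (v z - q z) ^ 2) (Set.Ioo (-ρ) ρ) :=
    h.int hρ (fun p => (p.2 - q p.1) ^ 2) (fun _ => 0) (fun _ => 0) (by fun_prop) (by fun_prop) (by fun_prop)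
      (fun z => by ring)
  have hφd : ∀ z ∈ Set.uIcc s b, HasDerivAt (fun z => m z * (v z - q z) ^ 2) (φ' z) z := by
    intro z hz
    rw [Set.uIcc_of_le hsb] at hz
    have hz' : z ∈ Set.Ioo (-ρ) ρ := ⟨by linarith [hz.1], by linarith [hz.2]⟩
    have h1 := (hmd z).mul (((h.hasDeriv hz').sub (hqd z)).pow 2)
    refine h1.congr_deriv ?_
    simp only [hφ', Pi.pow_apply, Pi.sub_apply]
    ring
  have hftc := intervalIntegral.integral_eq_sub_of_hasDerivAt hφd (ii_of hφi hs.le hsb hb.le)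
  have hpt : ∀ z ∈ Set.Ioo s b, φ' z ≤ -(1 / (2 * ε)) * (v z - q z) ^ 2 + 8 / ε * rr ε v z ^ 2 := by
    intro z hz
    have hq0 : 0 ≤ q z := th_nonneg (div_nonneg (by linarith [hz.1]) hε.le)
    have hq2 : q z ≤ 1 := (abs_lt.1 (Real.abs_tanh_lt_one ((z - s) / ε))).2.le
    refine ode_pt hε (hv z ⟨hz.1.le, hz.2.le⟩) hq0 ?_ ?_ ?_ rfl
    · simp only [hm]; field_simp [(hq1 z).ne']
    · simp only [hm]; rw [le_div_iff₀ (hq1 z)]; linarith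
    · simp only [hm]; rw [div_le_iff₀ (hq1 z)]; linarith
  have i1 := (ii_of hw hs.le hsb hb.le).const_mul (-(1 / (2 * ε)))
  have i2 := (ii_of (h.int_rr hρ ε) hs.le hsb hb.le).const_mul (8 / ε)
  have hle := ii_mono hsb (ii_of hφi hs.le hsb hb.le) (i1.add i2) hpt
  have e : ∫ z in s..b, (-(1 / (2 * ε)) * (v z - q z) ^ 2 + 8 / ε * rr ε v z ^ 2)
      = -(1 / (2 * ε)) * (∫ z in s..b, (v z - q z) ^ 2) + 8 / ε * ∫ z in s..b, rr ε v z ^ 2 := by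
    rw [intervalIntegral.integral_add i1 i2, intervalIntegral.integral_const_mul, intervalIntegral.integral_const_mul]
  have hle2 : φ' = φ' := rfl
  have hqs : q s = 0 := by simp [hq]
  have hnn : 0 ≤ ∫ z in s..b, φ' z := by
    rw [hftc, h0, hqs]
    have : 0 ≤ m b := (div_pos two_pos (hq1 b)).le
    have := mul_nonneg this (sq_nonneg (v b - q b))
    simpa using this
  have hle3 : 0 ≤ -(1 / (2 * ε)) * (∫ z in s..b, (v z - q z) ^ 2) + 8 / ε * ∫ z in s..b, rr ε v z ^ 2 := by
    rw [← e]; exact hnn.trans hle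
  have := mul_nonneg (show 0 ≤ 2 * ε by positivity) hle3
  have e3 : 2 * ε * (-(1 / (2 * ε)) * (∫ z in s..b, (v z - q z) ^ 2) + 8 / ε * ∫ z in s..b, rr ε v z ^ 2)
    = - (∫ z in s..b, (v z - q z) ^ 2) + 16 * ∫ z in s..b, rr ε v z ^ 2 := by field_simp; ring
  rw [e3] at this
  linarith

lemma Adm.sel {ρ : ℝ} {v : ℝ → ℝ} (h : Adm ρ v) (hρ : 0 < ρ) {ε η : ℝ} (hε : 0 < ε) (hη : 0 < η)
    (h1 : ∫ z in (ρ / 2)..ρ, (v z - 1) ^ 2 ≤ ρ / 400) :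
    ∃ b ∈ Set.Ioo (ρ / 2) ρ, 9 / 10 ≤ v b ∧ v b ≤ 11 / 10 ∧
      2 / 3 - (8 * ε / (3 * ρ)) * ((∫ z in (ρ / 2)..ρ, en ε v z) + η) ≤ Gf (v b) := by
  set E := ∫ z in (ρ / 2)..ρ, en ε v z with hE
  have hle : ρ / 2 ≤ ρ := by linarith
  have hE0 : 0 ≤ E := intervalIntegral.integral_nonneg hle fun z _ => en_nonneg hε v z
  have hEη : 0 < E + η := by linarith
  set k := ρ / (8 * ε * (E + η)) with hk
  have hk0 : 0 < k := by positivity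
  have key : ∃ b ∈ Set.Ioo (ρ / 2) ρ, 100 * (v b - 1) ^ 2 + k * (v b ^ 2 - 1) ^ 2 ≤ 1 := by
    by_contra hc
    push Not at hc
    have i1 : IntegrableOn (fun z => (v z - 1) ^ 2) (Set.Ioo (-ρ) ρ) :=
      h.int hρ (fun p => (p.2 - 1) ^ 2) (fun _ => 0) (fun _ => 0) (by fun_prop) (by fun_prop) (by fun_prop)
        (fun z => by ring)
    have i2 : IntegrableOn (fun z => (v z ^ 2 - 1) ^ 2) (Set.Ioo (-ρ) ρ) :=
      h.int hρ (fun p => (p.2 ^ 2 - 1) ^ 2) (fun _ => 0) (fun _ => 0) (by fun_prop) (by fun_prop) (by fun_prop)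
        (fun z => by ring)
    have j1 := ii_of i1 (show -ρ ≤ ρ / 2 by linarith) hle le_rfl
    have j2 := ii_of i2 (show -ρ ≤ ρ / 2 by linarith) hle le_rfl
    have j3 := ii_of (h.int_en hρ ε) (show -ρ ≤ ρ / 2 by linarith) hle le_rfl
    have m1 := ii_mono hle (f := fun _ => (1 : ℝ)) intervalIntegrable_const ((j1.const_mul 100).add (j2.const_mul k))
      (fun z hz => (hc z hz).le)
    rw [intervalIntegral.integral_add (j1.const_mul 100) (j2.const_mul k),
      intervalIntegral.integral_const_mul, intervalIntegral.integral_const_mul,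
      intervalIntegral.integral_const, smul_eq_mul, mul_one] at m1
    have m2 := ii_mono hle j2 (j3.const_mul (2 * ε)) (fun z _ => W_le_en hε v z)
    rw [intervalIntegral.integral_const_mul] at m2
    have m3 := mul_le_mul_of_nonneg_left m2 hk0.le
    have m4 : k * (2 * ε * E) < ρ / 4 := by
      have : k * (2 * ε * (E + η)) = ρ / 4 := by rw [hk]; field_simp; norm_num
      have h5 : 0 < k * (2 * ε * η) := by positivity
      nlinarith
    linarith
  obtain ⟨b, hb, hb2⟩ := key
  have hn1 : 0 ≤ k * (v b ^ 2 - 1) ^ 2 := by positivity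
  have hn2 : (v b - 1) ^ 2 ≤ (1 / 10) ^ 2 := by nlinarith
  have hab := abs_le.1 (abs_le_of_sq_le_sq hn2 (by norm_num))
  refine ⟨b, hb, by linarith, by linarith, ?_⟩
  have h3 : (v b ^ 2 - 1) ^ 2 ≤ (8 * ε / ρ) * (E + η) := by
    have h4 : k * (v b ^ 2 - 1) ^ 2 ≤ 1 := by nlinarith [sq_nonneg (v b - 1)]
    have h5 : (8 * ε / ρ) * (E + η) = k⁻¹ := by rw [hk]; field_simp
    rw [h5, ← one_div, le_div_iff₀ hk0]; linarith
  have h6 : (8 * ε / (3 * ρ)) * (E + η) = ((8 * ε / ρ) * (E + η)) / 3 := by field_simp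
  rw [h6]
  have h7 : 2 / 3 - Gf (v b) ≤ (v b ^ 2 - 1) ^ 2 / 3 := by
    unfold Gf
    have : (v b ^ 2 - 1) ^ 2 / 3 - (2 / 3 - (v b - v b ^ 3 / 3)) = (v b - 1) ^ 2 * ((v b + 1) ^ 2 - (2 + v b)) / 3 := by ring
    have h8 : 0 ≤ (v b + 1) ^ 2 - (2 + v b) := by nlinarith
    have h9 := mul_nonneg (sq_nonneg (v b - 1)) h8
    linarith
  linarith

lemma Gf_ge {t : ℝ} (h1 : 9 / 10 ≤ t) (h2 : t ≤ 11 / 10) : 65 / 100 ≤ Gf t := by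
  unfold Gf
  have h : t - t ^ 3 / 3 = 2 / 3 - (t - 1) ^ 2 * (2 + t) / 3 := by ring
  have h3 : (t - 1) ^ 2 ≤ 1 / 100 := by nlinarith
  have h4 : (t - 1) ^ 2 * (2 + t) ≤ 1 / 100 * (2 + t) := mul_le_mul_of_nonneg_right h3 (by linarith)
  linarith

/-- One-sided estimate. -/
lemma Adm.half {ρ : ℝ} {v : ℝ → ℝ} (h : Adm ρ v) (hρ : 0 < ρ) {ε T : ℝ} (hε : 0 < ε) {s b : ℝ}
    (hs : -ρ < s) (hs4 : s ≤ ρ / 4) (hb0 : ρ / 2 < b) (hb : b < ρ) (h0 : v s = 0) (hb1 : 9 / 10 ≤ v b) (hb2 : v b ≤ 11 / 10)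
    (hT : T ≤ 1 / 10)
    (hR : ∫ z in s..b, rr ε v z ^ 2 ≤ 2 * ε * T) (hB : ∫ z in b..ρ, en ε v z ≤ T) :
    (∀ z ∈ Set.Ico s ρ, |v z| ≤ 2) ∧
    ∫ z in s..ρ, (v z - Real.tanh ((z - s) / ε)) ^ 2 ≤ 36 * ε * T + 4 * ρ * etaE ρ ε ^ 4 ∧
    ∫ z in s..ρ, rr ε v z ^ 2 ≤ 6 * ε * T := by
  have hsb : s ≤ b := by linarith
  have ht := h.trap_right hρ hε hs hb h0 hT hR
  have ho := h.ode_right hρ hε hs hsb hb h0 (fun z hz => (ht z hz).1)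
  have hB2 : ∀ z ∈ Set.Ico b ρ, 1 / 4 < v z ∧ v z < 2 := by
    intro z hz
    refine trap hz.1 (h.cont.mono fun y hy => ⟨by linarith [hy.1], by linarith [hy.2, hz.2]⟩)
      (by linarith) (by linarith) ?_
    intro y hy
    have hyρ : y < ρ := hy.2.trans_lt hz.2
    have h1 := h.G_ge_en hρ hε (show -ρ < b by linarith) hy.1 hyρ
    have h2 : ∫ z in b..y, en ε v z ≤ ∫ z in b..ρ, en ε v z :=
      intervalIntegral.integral_mono_interval le_rfl hy.1 hyρ.le
        (Filter.Eventually.of_forall fun z => en_nonneg hε v z) (ii_of (h.int_en hρ ε) (by linarith) hb.le le_rfl)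
    have h3 := Gf_ge hb1 hb2
    constructor
    · intro hv; rw [hv] at h1; have : Gf (1 / 4) ≤ 1 / 4 := by unfold Gf; norm_num
      linarith
    · intro hv; rw [hv] at h1; have : Gf 2 ≤ 0 := by unfold Gf; norm_num
      linarith
  have hw : IntegrableOn (fun z => (v z - Real.tanh ((z - s) / ε)) ^ 2) (Set.Ioo (-ρ) ρ) :=
    (h.memLp.sub (tq_memLp ρ ε s)).integrable_sq
  have jw1 := ii_of hw hs.le hsb hb.le
  have jw2 := ii_of hw (show -ρ ≤ b by linarith) hb.le le_rfl
  have jr1 := ii_of (h.int_rr hρ ε) hs.le hsb hb.le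
  have jr2 := ii_of (h.int_rr hρ ε) (show -ρ ≤ b by linarith) hb.le le_rfl
  have je := ii_of (h.int_en hρ ε) (show -ρ ≤ b by linarith) hb.le le_rfl
  refine ⟨?_, ?_, ?_⟩
  · intro z hz
    rw [abs_le]
    by_cases hzb : z ≤ b
    · have := ht z ⟨hz.1, hzb⟩; constructor <;> linarith
    · have := hB2 z ⟨by linarith, hz.2⟩; constructor <;> linarith
  · rw [← intervalIntegral.integral_add_adjacent_intervals jw1 jw2]
    have hη := etaE_pos ρ ε
    have m := ii_mono hb.le jw2 ((je.const_mul (4 * ε)).add (intervalIntegrable_const (c := 8 * etaE ρ ε ^ 4))) (by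
      intro z hz
      have h1 := hB2 z ⟨hz.1.le, hz.2⟩
      have h2 := W_le_en hε v z
      have h3 := tanh_far (ρ := ρ) hε (show ρ / 4 ≤ z - s by linarith [hz.1])
      have h4 : Real.tanh ((z - s) / ε) ≤ 1 := (abs_lt.1 (Real.abs_tanh_lt_one ((z - s) / ε))).2.le
      have h5 : (v z - 1) ^ 2 ≤ (v z ^ 2 - 1) ^ 2 := by
        have : (v z ^ 2 - 1) ^ 2 = (v z - 1) ^ 2 * (v z + 1) ^ 2 := by ring
        rw [this]
        exact le_mul_of_one_le_right (sq_nonneg _) (by nlinarith)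
      have h6 : (1 - Real.tanh ((z - s) / ε)) ^ 2 ≤ (2 * etaE ρ ε ^ 2) ^ 2 := by
        gcongr
      show (v z - Real.tanh ((z - s) / ε)) ^ 2 ≤ 4 * ε * en ε v z + 8 * etaE ρ ε ^ 4
      nlinarith [sq_nonneg ((v z - 1) - (1 - Real.tanh ((z - s) / ε)))])
    rw [intervalIntegral.integral_add (je.const_mul _) intervalIntegrable_const, intervalIntegral.integral_const_mul,
      intervalIntegral.integral_const, smul_eq_mul] at m
    have h7 : (ρ - b) * (8 * etaE ρ ε ^ 4) ≤ (ρ / 2) * (8 * etaE ρ ε ^ 4) := by gcongr; linarith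
    have h8 : 4 * ε * (∫ z in b..ρ, en ε v z) ≤ 4 * ε * T := by gcongr
    linarith
  · rw [← intervalIntegral.integral_add_adjacent_intervals jr1 jr2]
    have m := ii_mono hb.le jr2 (je.const_mul (4 * ε)) (fun z _ => rr_le_en hε v z)
    rw [intervalIntegral.integral_const_mul] at m
    have h8 : 4 * ε * (∫ z in b..ρ, en ε v z) ≤ 4 * ε * T := by gcongr
    linarith

lemma Adm.shift_bound {ρ : ℝ} {v : ℝ → ℝ} (h : Adm ρ v) (hρ : 0 < ρ) {ε P : ℝ} (hε : 0 < ε) {s b : ℝ}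
    (hs : 0 ≤ s) (hsb : s ≤ b) (hb : b < ρ) (h0 : v s = 0) (hb1 : 9 / 10 ≤ v b) (hb2 : v b ≤ 11 / 10)
    (hP : ∫ z in (-ρ)..ρ, z ^ 2 * en ε v z ≤ P) : s ^ 2 ≤ 2 * P := by
  have jz := ii_of (h.int_zen hρ ε) (show -ρ ≤ s by linarith) hsb hb.le
  have je := ii_of (h.int_en hρ ε) (show -ρ ≤ s by linarith) hsb hb.le
  have jG := ii_of (h.int_G hρ) (show -ρ ≤ s by linarith) hsb hb.le
  have h1 : ∫ z in s..b, z ^ 2 * en ε v z ≤ ∫ z in (-ρ)..ρ, z ^ 2 * en ε v z :=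
    intervalIntegral.integral_mono_interval (by linarith) hsb hb.le
      (Filter.Eventually.of_forall fun z => mul_nonneg (sq_nonneg z) (en_nonneg hε v z))
      (ii_of (h.int_zen hρ ε) le_rfl (by linarith) le_rfl)
  have h2 := ii_mono hsb (je.const_mul (s ^ 2)) jz (fun z hz => by
    refine mul_le_mul_of_nonneg_right ?_ (en_nonneg hε v z)
    have := hz.1; nlinarith)
  have h3 := ii_mono hsb jG je (fun z _ => en_ge_pos hε v z)
  rw [h.ftcG hρ (by linarith) hsb hb, h0] at h3
  rw [intervalIntegral.integral_const_mul] at h2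
  have h4 := Gf_ge hb1 hb2
  have h5 : Gf 0 = 0 := by unfold Gf; norm_num
  have h6 : s ^ 2 * (65 / 100) ≤ s ^ 2 * ∫ z in s..b, en ε v z := by gcongr; linarith
  nlinarith [sq_nonneg s]

lemma theta1_eq {ρ ε : ℝ} (hρ : 0 < ρ) {v : ℝ → ℝ} (h : Adm ρ v) :
    theta1 ρ ε v = (∫ z in (-ρ)..ρ, z ^ 2 * en ε v z) + (∫ z in (-ρ)..ρ, en ε v z) - 4 / 3 := by
  have j1 := ii_of (h.int_zen hρ ε) le_rfl (show -ρ ≤ ρ by linarith) le_rfl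
  have j2 := ii_of (h.int_en hρ ε) le_rfl (show -ρ ≤ ρ by linarith) le_rfl
  rw [← intervalIntegral.integral_add j1 j2, intervalIntegral.integral_of_le (by linarith),
    integral_Ioc_eq_integral_Ioo]
  unfold theta1
  congr 1
  refine integral_congr_ae (Filter.Eventually.of_forall fun z => ?_)
  simp only [en]
  ring

lemma refl_int_sq (v : ℝ → ℝ) (ρ : ℝ) :
    ∫ z in (ρ / 2)..ρ, (-v (-z) - 1) ^ 2 = ∫ z in (-ρ)..(-(ρ / 2)), (v z + 1) ^ 2 := by
  rw [← intervalIntegral.integral_comp_neg (fun z => (v z + 1) ^ 2)]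
  congr 1
  funext z
  ring

lemma refl_int_en (ε : ℝ) (v : ℝ → ℝ) (x y : ℝ) :
    ∫ z in x..y, en ε (fun z => -v (-z)) z = ∫ z in (-y)..(-x), en ε v z := by
  rw [← intervalIntegral.integral_comp_neg (fun z => en ε v z)]
  congr 1
  funext z
  exact refl_en ε v z

lemma refl_int_rr (ε : ℝ) (v : ℝ → ℝ) (x y : ℝ) :
    ∫ z in x..y, rr ε (fun z => -v (-z)) z ^ 2 = ∫ z in (-y)..(-x), rr ε v z ^ 2 := by
  rw [← intervalIntegral.integral_comp_neg (fun z => rr ε v z ^ 2)]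
  congr 1
  funext z
  rw [refl_rr ε v z]

lemma refl_int_zen (ε : ℝ) (v : ℝ → ℝ) (x y : ℝ) :
    ∫ z in x..y, z ^ 2 * en ε (fun z => -v (-z)) z = ∫ z in (-y)..(-x), z ^ 2 * en ε v z := by
  rw [← intervalIntegral.integral_comp_neg (fun z => z ^ 2 * en ε v z)]
  congr 1
  funext z
  rw [refl_en ε v z, neg_sq]

lemma refl_int_w (ε s : ℝ) (v : ℝ → ℝ) (x y : ℝ) :
    ∫ z in x..y, (-v (-z) - Real.tanh ((z - -s) / ε)) ^ 2
      = ∫ z in (-y)..(-x), (v z - Real.tanh ((z - s) / ε)) ^ 2 := by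
  rw [← intervalIntegral.integral_comp_neg (fun z => (v z - Real.tanh ((z - s) / ε)) ^ 2)]
  congr 1
  funext z
  have : (z - -s) / ε = -((-z - s) / ε) := by ring
  rw [this, Real.tanh_neg]
  ring

lemma Adm.sel2 {ρ : ℝ} {v : ℝ → ℝ} (h : Adm ρ v) (hρ : 0 < ρ) {ε η : ℝ} (hε : 0 < ε) (hη : 0 < η)
    (hk1 : 8 * ε / (3 * ρ) ≤ ρ ^ 2 / 8) (hk2 : 8 * ε / (3 * ρ) ≤ 1 / 2)
    (h1 : ∫ z in (ρ / 2)..ρ, (v z - 1) ^ 2 ≤ ρ / 400)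
    (h2 : ∫ z in (-ρ)..(-(ρ / 2)), (v z + 1) ^ 2 ≤ ρ / 400) :
    ∃ a b : ℝ, ρ / 2 < a ∧ a < ρ ∧ ρ / 2 < b ∧ b < ρ ∧ 9 / 10 ≤ v b ∧ v b ≤ 11 / 10 ∧
      9 / 10 ≤ -v (-a) ∧ -v (-a) ≤ 11 / 10 ∧
      1 / 2 * (∫ z in (-ρ)..ρ, z ^ 2 * en ε v z) + 1 / (2 * ε) * (∫ z in (-a)..b, rr ε v z ^ 2)
        + (∫ z in (-ρ)..(-a), en ε v z) + (∫ z in b..ρ, en ε v z) ≤ theta1 ρ ε v + η := by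
  obtain ⟨b, hb, hb1, hb2, hb3⟩ := h.sel hρ hε hη h1
  obtain ⟨a, ha, ha1, ha2, ha3⟩ := h.refl.sel hρ hε hη (by rw [refl_int_sq]; exact h2)
  refine ⟨a, b, ha.1, ha.2, hb.1, hb.2, hb1, hb2, ha1, ha2, ?_⟩
  obtain ⟨hb5, hb6⟩ := hb
  obtain ⟨ha5, ha6⟩ := ha
  rw [refl_int_en] at ha3
  rw [Gf_neg] at ha3
  have hab : -a ≤ b := by linarith
  have hi := h.int_en hρ ε
  have hz := h.int_zen hρ ε
  -- split the energy
  have s1 := intervalIntegral.integral_add_adjacent_intervals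
    (ii_of hi le_rfl (show -ρ ≤ -a by linarith) (by linarith)) (ii_of hi (by linarith) hab hb6.le)
  have s2 := intervalIntegral.integral_add_adjacent_intervals
    (ii_of hi le_rfl (show -ρ ≤ b by linarith) (by linarith)) (ii_of hi (by linarith) hb6.le le_rfl)
  have s3 := intervalIntegral.integral_add_adjacent_intervals
    (ii_of hz le_rfl (show -ρ ≤ -(ρ / 2) by linarith) (by linarith))
    (ii_of hz (show -ρ ≤ -(ρ / 2) by linarith) (show -(ρ / 2) ≤ ρ / 2 by linarith) (by linarith))
  have s4 := intervalIntegral.integral_add_adjacent_intervals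
    (ii_of hz le_rfl (show -ρ ≤ ρ / 2 by linarith) (by linarith))
    (ii_of hz (show -ρ ≤ ρ / 2 by linarith) (show ρ / 2 ≤ ρ by linarith) le_rfl)
  have n1 : 0 ≤ ∫ z in (-(ρ / 2))..(ρ / 2), z ^ 2 * en ε v z :=
    intervalIntegral.integral_nonneg (by linarith) fun z _ => mul_nonneg (sq_nonneg z) (en_nonneg hε v z)
  have p1 := ii_mono (show ρ / 2 ≤ ρ by linarith)
    ((ii_of hi (show -ρ ≤ ρ / 2 by linarith) (by linarith) le_rfl).const_mul (ρ ^ 2 / 4))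
    (ii_of hz (show -ρ ≤ ρ / 2 by linarith) (by linarith) le_rfl)
    (fun z hz => mul_le_mul_of_nonneg_right (by nlinarith [hz.1]) (en_nonneg hε v z))
  have p2 := ii_mono (show -ρ ≤ -(ρ / 2) by linarith)
    ((ii_of hi le_rfl (show -ρ ≤ -(ρ / 2) by linarith) (by linarith)).const_mul (ρ ^ 2 / 4))
    (ii_of hz le_rfl (show -ρ ≤ -(ρ / 2) by linarith) (by linarith))
    (fun z hz => mul_le_mul_of_nonneg_right (by nlinarith [hz.2]) (en_nonneg hε v z))
  rw [intervalIntegral.integral_const_mul] at p1 p2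
  have n2 : 0 ≤ ∫ z in (ρ / 2)..ρ, en ε v z :=
    intervalIntegral.integral_nonneg (by linarith) fun z _ => en_nonneg hε v z
  have n3 : 0 ≤ ∫ z in (-ρ)..(-(ρ / 2)), en ε v z :=
    intervalIntegral.integral_nonneg (by linarith) fun z _ => en_nonneg hε v z
  -- middle part
  have mid : ∫ z in (-a)..b, en ε v z = 1 / (2 * ε) * (∫ z in (-a)..b, rr ε v z ^ 2) + (Gf (v b) - Gf (v (-a))) := by
    rw [← h.ftcG hρ (by linarith) hab hb6, ← intervalIntegral.integral_const_mul,
      ← intervalIntegral.integral_add ((ii_of (h.int_rr hρ ε) (by linarith) hab hb6.le).const_mul _)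
        (ii_of (h.int_G hρ) (by linarith) hab hb6.le)]
    congr 1
    funext z
    exact en_eq hε v z
  rw [theta1_eq hρ h]
  set k := 8 * ε / (3 * ρ) with hk
  set E1 := ∫ z in (ρ / 2)..ρ, en ε v z
  set E2 := ∫ z in (-ρ)..(-(ρ / 2)), en ε v z
  have q1 : k * E1 ≤ ρ ^ 2 / 8 * E1 := mul_le_mul_of_nonneg_right hk1 n2
  have q2 : k * E2 ≤ ρ ^ 2 / 8 * E2 := mul_le_mul_of_nonneg_right hk1 n3
  have q3 : k * η ≤ 1 / 2 * η := mul_le_mul_of_nonneg_right hk2 hη.le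
  rw [mul_add] at ha3 hb3
  linarith

lemma Adm.theta1_nonneg {ρ : ℝ} {v : ℝ → ℝ} (h : Adm ρ v) (hρ : 0 < ρ) {ε : ℝ} (hε : 0 < ε)
    (hk1 : 8 * ε / (3 * ρ) ≤ ρ ^ 2 / 8) (hk2 : 8 * ε / (3 * ρ) ≤ 1 / 2)
    (h1 : ∫ z in (ρ / 2)..ρ, (v z - 1) ^ 2 ≤ ρ / 400)
    (h2 : ∫ z in (-ρ)..(-(ρ / 2)), (v z + 1) ^ 2 ≤ ρ / 400) : 0 ≤ theta1 ρ ε v := by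
  refine le_of_forall_pos_le_add fun η hη => ?_
  obtain ⟨a, b, ha5, ha6, hb5, hb6, -, -, -, -, hT⟩ := h.sel2 hρ hε hη hk1 hk2 h1 h2
  have n1 : 0 ≤ ∫ z in (-ρ)..ρ, z ^ 2 * en ε v z :=
    intervalIntegral.integral_nonneg (by linarith) fun z _ => mul_nonneg (sq_nonneg z) (en_nonneg hε v z)
  have n2 : 0 ≤ ∫ z in (-a)..b, rr ε v z ^ 2 :=
    intervalIntegral.integral_nonneg (by linarith) fun z _ => sq_nonneg _
  have n3 : 0 ≤ ∫ z in (-ρ)..(-a), en ε v z :=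
    intervalIntegral.integral_nonneg (by linarith) fun z _ => en_nonneg hε v z
  have n4 : 0 ≤ ∫ z in b..ρ, en ε v z :=
    intervalIntegral.integral_nonneg (by linarith) fun z _ => en_nonneg hε v z
  have n5 : 0 ≤ 1 / (2 * ε) * (∫ z in (-a)..b, rr ε v z ^ 2) := by positivity
  linarith

/-- The energy estimate. -/
lemma Adm.energy {ρ : ℝ} {v : ℝ → ℝ} (h : Adm ρ v) (hρ : 0 < ρ) {ε T : ℝ} (hε : 0 < ε)
    (hk1 : 8 * ε / (3 * ρ) ≤ ρ ^ 2 / 8) (hk2 : 8 * ε / (3 * ρ) ≤ 1 / 2)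
    (h1 : ∫ z in (ρ / 2)..ρ, (v z - 1) ^ 2 ≤ ρ / 400)
    (h2 : ∫ z in (-ρ)..(-(ρ / 2)), (v z + 1) ^ 2 ≤ ρ / 400)
    (hT : theta1 ρ ε v < T) (hT1 : T ≤ 1 / 10) (hT2 : T ≤ ρ ^ 2 / 64) :
    ∃ s, |s| ≤ ρ / 4 ∧ s ^ 2 ≤ 4 * T ∧ (∀ z ∈ Set.Ioo (-ρ) ρ, |v z| ≤ 2) ∧
      ∫ z in Set.Ioo (-ρ) ρ, (v z - Real.tanh ((z - s) / ε)) ^ 2 ≤ 72 * ε * T + 8 * ρ * etaE ρ ε ^ 4 ∧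
      ∫ z in Set.Ioo (-ρ) ρ, rr ε v z ^ 2 ≤ 12 * ε * T := by
  obtain ⟨a, b, ha5, ha6, hb5, hb6, hb1, hb2, ha1, ha2, hTT⟩ :=
    h.sel2 hρ hε (sub_pos.2 hT) hk1 hk2 h1 h2
  rw [add_sub_cancel] at hTT
  have n1 : 0 ≤ ∫ z in (-ρ)..ρ, z ^ 2 * en ε v z :=
    intervalIntegral.integral_nonneg (by linarith) fun z _ => mul_nonneg (sq_nonneg z) (en_nonneg hε v z)
  have n2 : 0 ≤ ∫ z in (-a)..b, rr ε v z ^ 2 :=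
    intervalIntegral.integral_nonneg (by linarith) fun z _ => sq_nonneg _
  have n3 : 0 ≤ ∫ z in (-ρ)..(-a), en ε v z :=
    intervalIntegral.integral_nonneg (by linarith) fun z _ => en_nonneg hε v z
  have n4 : 0 ≤ ∫ z in b..ρ, en ε v z :=
    intervalIntegral.integral_nonneg (by linarith) fun z _ => en_nonneg hε v z
  have n5 : 0 ≤ 1 / (2 * ε) * (∫ z in (-a)..b, rr ε v z ^ 2) := by positivity
  have r1 : ∫ z in (-a)..b, rr ε v z ^ 2 ≤ 2 * ε * T := by
    have : 2 * ε * (1 / (2 * ε) * (∫ z in (-a)..b, rr ε v z ^ 2)) ≤ 2 * ε * T := by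
      gcongr; linarith
    have e : 2 * ε * (1 / (2 * ε) * (∫ z in (-a)..b, rr ε v z ^ 2)) = ∫ z in (-a)..b, rr ε v z ^ 2 := by
      field_simp
    linarith
  -- the zero
  obtain ⟨s, hs, hs0⟩ : ∃ s ∈ Set.Icc (-a) b, v s = 0 :=
    intermediate_value_Icc (show -a ≤ b by linarith)
      (h.cont.mono fun y hy => ⟨by linarith [hy.1], by linarith [hy.2]⟩) ⟨by linarith, by linarith⟩
  have hP : ∫ z in (-ρ)..ρ, z ^ 2 * en ε v z ≤ 2 * T := by linarith
  have hu0 : (fun z => -v (-z)) (-s) = 0 := by simp [hs0]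
  have hs2 : s ^ 2 ≤ 4 * T := by
    rcases le_total 0 s with h0 | h0
    · have := h.shift_bound hρ hε h0 hs.2 hb6 hs0 hb1 hb2 hP
      linarith
    · have := h.refl.shift_bound (P := 2 * T) hρ hε (show 0 ≤ -s by linarith) (show -s ≤ a by linarith [hs.1]) ha6 hu0 ha1 ha2
        (by rw [refl_int_zen, neg_neg]; exact hP)
      nlinarith
  have hsρ : |s| ≤ ρ / 4 := abs_le_of_sq_le_sq (by nlinarith) (by linarith)
  have hsρ' := abs_le.1 hsρ
  have rA : ∫ z in s..b, rr ε v z ^ 2 ≤ 2 * ε * T :=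
    (intervalIntegral.integral_mono_interval hs.1 hs.2 le_rfl
        (Filter.Eventually.of_forall fun z => sq_nonneg _) (ii_of (h.int_rr hρ ε) (by linarith) (by linarith) hb6.le)).trans r1
  have rB : ∫ z in (-a)..s, rr ε v z ^ 2 ≤ 2 * ε * T :=
    (intervalIntegral.integral_mono_interval le_rfl hs.1 hs.2
        (Filter.Eventually.of_forall fun z => sq_nonneg _) (ii_of (h.int_rr hρ ε) (by linarith) (by linarith) hb6.le)).trans r1
  obtain ⟨A1, A2, A3⟩ := h.half hρ hε (show -ρ < s by linarith) hsρ'.2 hb5 hb6 hs0 hb1 hb2 hT1 rA (by linarith)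
  obtain ⟨B1, B2, B3⟩ := h.refl.half hρ hε (show -ρ < -s by linarith) (by linarith) ha5 ha6 hu0 ha1 ha2 hT1
    (by rw [refl_int_rr, neg_neg]; exact rB) (by rw [refl_int_en]; linarith)
  rw [refl_int_w, neg_neg] at B2
  rw [refl_int_rr, neg_neg] at B3
  have hw : IntegrableOn (fun z => (v z - Real.tanh ((z - s) / ε)) ^ 2) (Set.Ioo (-ρ) ρ) :=
    (h.memLp.sub (tq_memLp ρ ε s)).integrable_sq
  refine ⟨s, hsρ, hs2, ?_, ?_, ?_⟩
  · intro z hz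
    rcases le_total s z with h0 | h0
    · exact A1 z ⟨h0, hz.2⟩
    · have := B1 (-z) ⟨by linarith, by linarith [hz.1]⟩
      simpa using this
  · rw [← integral_Ioc_eq_integral_Ioo, ← intervalIntegral.integral_of_le (by linarith),
      ← intervalIntegral.integral_add_adjacent_intervals (b := s)
        (ii_of hw le_rfl (by linarith) (by linarith)) (ii_of hw (by linarith) (by linarith) le_rfl)]
    linarith
  · rw [← integral_Ioc_eq_integral_Ioo, ← intervalIntegral.integral_of_le (by linarith),
      ← intervalIntegral.integral_add_adjacent_intervals (b := s)
        (ii_of (h.int_rr hρ ε) le_rfl (by linarith) (by linarith)) (ii_of (h.int_rr hρ ε) (by linarith) (by linarith) le_rfl)]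
    linarith

/-! ### Assembly -/

lemma eps_small {ρ A : ℝ} (hρ : 0 < ρ) (hA : 0 < A) :
    ∃ ε₀ > 0, ∀ ε, 0 < ε → ε < ε₀ → ε ≤ A ∧ ε ≤ 1 ∧ etaE ρ ε ≤ ε ^ 2 := by
  refine ⟨min A (min 1 (ρ ^ 3 / 384)), by positivity, fun ε hε h => ?_⟩
  rw [lt_min_iff, lt_min_iff] at h
  refine ⟨h.1.le, h.2.1.le, ?_⟩
  have h1 := Real.pow_div_factorial_le_exp (x := ρ / 4 / ε) (by positivity) 3
  have h2 : (Nat.factorial 3 : ℝ) = 6 := by norm_num [Nat.factorial]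
  rw [h2] at h1
  have h3 : etaE ρ ε * Real.exp (ρ / 4 / ε) = 1 := by
    unfold etaE
    rw [← Real.exp_add]
    have : -(ρ / 4) / ε + ρ / 4 / ε = 0 := by ring
    rw [this, Real.exp_zero]
  have h4 : etaE ρ ε * ((ρ / 4 / ε) ^ 3 / 6) ≤ 1 := by
    rw [← h3]; exact mul_le_mul_of_nonneg_left h1 (etaE_pos ρ ε).le
  have h5 : (ρ / 4 / ε) ^ 3 / 6 = ρ ^ 3 / 384 / ε ^ 3 := by
    field_simp; norm_num
  rw [h5] at h4
  have h6 : etaE ρ ε * (ε / ε ^ 3) ≤ 1 := by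
    refine le_trans ?_ h4
    have := h.2.2.le
    have := etaE_pos ρ ε
    gcongr
  have h7 : etaE ρ ε * (ε / ε ^ 3) = etaE ρ ε / ε ^ 2 := by field_simp
  rw [h7, div_le_one (by positivity)] at h6
  exact h6

lemma theta2_right {ρ : ℝ} {v : ℝ → ℝ} (h : Adm ρ v) (hρ : 0 < ρ) (h2 : theta2 ρ v ≤ ρ ^ 2 / 800) :
    ∫ z in (ρ / 2)..ρ, (v z - 1) ^ 2 ≤ ρ / 400 ∧ ∫ z in (-ρ)..(-(ρ / 2)), (v z + 1) ^ 2 ≤ ρ / 400 := by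
  have hi : IntegrableOn (fun z => |z| * (v z - Real.sign z) ^ 2) (Set.Ioo (-ρ) ρ) := by
    refine h.int hρ (fun p => |p.1| * p.2 ^ 2 - 2 * p.1 * p.2 + |p.1|) (fun _ => 0) (fun _ => 0)
      (by fun_prop) (by fun_prop) (by fun_prop) (fun z => ?_)
    rcases lt_trichotomy z 0 with hz | hz | hz
    · rw [Real.sign_of_neg hz, abs_of_neg hz]; ring
    · simp [hz]
    · rw [Real.sign_of_pos hz, abs_of_pos hz]; ring
  have i1 : IntegrableOn (fun z => (v z - 1) ^ 2) (Set.Ioo (-ρ) ρ) :=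
    h.int hρ (fun p => (p.2 - 1) ^ 2) (fun _ => 0) (fun _ => 0) (by fun_prop) (by fun_prop) (by fun_prop)
      (fun z => by ring)
  have i2 : IntegrableOn (fun z => (v z + 1) ^ 2) (Set.Ioo (-ρ) ρ) :=
    h.int hρ (fun p => (p.2 + 1) ^ 2) (fun _ => 0) (fun _ => 0) (by fun_prop) (by fun_prop) (by fun_prop)
      (fun z => by ring)
  have ht : theta2 ρ v = ∫ z in (-ρ)..ρ, |z| * (v z - Real.sign z) ^ 2 := by
    rw [intervalIntegral.integral_of_le (by linarith), integral_Ioc_eq_integral_Ioo]; rfl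
  have jt := ii_of hi le_rfl (show -ρ ≤ ρ by linarith) le_rfl
  have nn : 0 ≤ᵐ[volume.restrict (Set.Ioc (-ρ) ρ)] fun z => |z| * (v z - Real.sign z) ^ 2 :=
    Filter.Eventually.of_forall fun z => mul_nonneg (abs_nonneg z) (sq_nonneg _)
  constructor
  · have m1 := intervalIntegral.integral_mono_interval (show -ρ ≤ ρ / 2 by linarith) (show ρ / 2 ≤ ρ by linarith) le_rfl
      nn jt
    have m2 := ii_mono (show ρ / 2 ≤ ρ by linarith)
      ((ii_of i1 (show -ρ ≤ ρ / 2 by linarith) (by linarith) le_rfl).const_mul (ρ / 2))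
      (ii_of hi (show -ρ ≤ ρ / 2 by linarith) (by linarith) le_rfl) (fun z hz => by
        have hz0 : 0 < z := by linarith [hz.1]
        rw [Real.sign_of_pos hz0, abs_of_pos hz0]
        exact mul_le_mul_of_nonneg_right hz.1.le (sq_nonneg _))
    rw [intervalIntegral.integral_const_mul] at m2
    have : ρ / 2 * (∫ z in (ρ / 2)..ρ, (v z - 1) ^ 2) ≤ ρ / 2 * (ρ / 400) := by
      rw [← ht] at m1; nlinarith
    exact le_of_mul_le_mul_left this (by linarith)
  · have m1 := intervalIntegral.integral_mono_interval le_rfl (show -ρ ≤ -(ρ / 2) by linarith) (show -(ρ / 2) ≤ ρ by linarith)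
      nn jt
    have m2 := ii_mono (show -ρ ≤ -(ρ / 2) by linarith)
      ((ii_of i2 le_rfl (show -ρ ≤ -(ρ / 2) by linarith) (by linarith)).const_mul (ρ / 2))
      (ii_of hi le_rfl (show -ρ ≤ -(ρ / 2) by linarith) (by linarith)) (fun z hz => by
        have hz0 : z < 0 := by linarith [hz.2]
        rw [Real.sign_of_neg hz0, abs_of_neg hz0, sub_neg_eq_add]
        exact mul_le_mul_of_nonneg_right (by linarith [hz.2]) (sq_nonneg _))
    rw [intervalIntegral.integral_const_mul] at m2
    have : ρ / 2 * (∫ z in (-ρ)..(-(ρ / 2)), (v z + 1) ^ 2) ≤ ρ / 2 * (ρ / 400) := by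
      rw [← ht] at m1; nlinarith
    exact le_of_mul_le_mul_left this (by linarith)

lemma close_right {ρ : ℝ} {χ : ℝ → ℝ} (hρ : 0 < ρ) (hχs : ContDiff ℝ (⊤ : ℕ∞) χ) (hχe : ∀ z, χ (-z) = χ z)
    (hχr : ∀ z, χ z ∈ Set.Icc (0 : ℝ) 1)
    (hχ1 : ∀ z, |z| ≤ ρ / 3 → χ z = 1) {ε : ℝ} (hε : 0 < ε) (hε2 : ε ≤ ρ / 12)
    (hη : 64 * ρ * etaE ρ ε ^ 4 ≤ (1 / 4000) ^ 2 * ε) {v : ℝ → ℝ} (h : Adm ρ v) {s : ℝ} (hs : |s| ≤ ρ / 4)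
    (hF : FQ ρ χ ε v s ≤ (1 / 4000) ^ 2 * ε) :
    ∫ z in (ρ / 2)..ρ, (v z - 1) ^ 2 ≤ ρ / 400 ∧ ∫ z in (-ρ)..(-(ρ / 2)), (v z + 1) ^ 2 ≤ ρ / 400 := by
  have hs' := abs_le.1 hs
  have i1 : IntegrableOn (fun z => (v z - 1) ^ 2) (Set.Ioo (-ρ) ρ) :=
    h.int hρ (fun p => (p.2 - 1) ^ 2) (fun _ => 0) (fun _ => 0) (by fun_prop) (by fun_prop) (by fun_prop)
      (fun z => by ring)
  have i2 : IntegrableOn (fun z => (v z + 1) ^ 2) (Set.Ioo (-ρ) ρ) :=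
    h.int hρ (fun p => (p.2 + 1) ^ 2) (fun _ => 0) (fun _ => 0) (by fun_prop) (by fun_prop) (by fun_prop)
      (fun z => by ring)
  have hi := FQ_int hρ hχs hχr hχ1 ε s h.memLp
  have ht : FQ ρ χ ε v s = ∫ z in (-ρ)..ρ, (v z - Qeps χ ε (z - s)) ^ 2 := by
    rw [intervalIntegral.integral_of_le (by linarith), integral_Ioc_eq_integral_Ioo]; rfl
  rw [ht] at hF
  have jt := ii_of hi le_rfl (show -ρ ≤ ρ by linarith) le_rfl
  have nn : 0 ≤ᵐ[volume.restrict (Set.Ioc (-ρ) ρ)] fun z => (v z - Qeps χ ε (z - s)) ^ 2 :=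
    Filter.Eventually.of_forall fun z => sq_nonneg _
  have hη0 := etaE_pos ρ ε
  constructor
  · have m1 := intervalIntegral.integral_mono_interval (show -ρ ≤ ρ / 2 by linarith) (show ρ / 2 ≤ ρ by linarith) le_rfl
      nn jt
    have j2 := (ii_of hi (show -ρ ≤ ρ / 2 by linarith) (show ρ / 2 ≤ ρ by linarith) le_rfl).const_mul 2
    have m2 := ii_mono (show ρ / 2 ≤ ρ by linarith)
      (ii_of i1 (show -ρ ≤ ρ / 2 by linarith) (by linarith) le_rfl)
      (j2.add (intervalIntegrable_const (c := 32 * etaE ρ ε ^ 4))) (fun z hz => by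
        have h1 := tanh_far (ρ := ρ) hε (show ρ / 4 ≤ z - s by linarith [hz.1])
        have h2 := abs_le.1 (Q_sub_tanh hχ1 hρ hχr hχe hε (z - s))
        have h3 := (abs_le.1 (Q_abs_le hχr ε (z - s))).2
        have h4 : (1 - Qeps χ ε (z - s)) ^ 2 ≤ (4 * etaE ρ ε ^ 2) ^ 2 := by
          have : 0 ≤ 1 - Qeps χ ε (z - s) := by linarith
          gcongr; linarith
        show (v z - 1) ^ 2 ≤ 2 * (v z - Qeps χ ε (z - s)) ^ 2 + 32 * etaE ρ ε ^ 4
        nlinarith [sq_nonneg ((v z - Qeps χ ε (z - s)) + (1 - Qeps χ ε (z - s)))])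
    rw [intervalIntegral.integral_add j2 intervalIntegrable_const, intervalIntegral.integral_const_mul,
      intervalIntegral.integral_const, smul_eq_mul] at m2
    nlinarith
  · have m1 := intervalIntegral.integral_mono_interval le_rfl (show -ρ ≤ -(ρ / 2) by linarith) (show -(ρ / 2) ≤ ρ by linarith)
      nn jt
    have j2 := (ii_of hi le_rfl (show -ρ ≤ -(ρ / 2) by linarith) (show -(ρ / 2) ≤ ρ by linarith)).const_mul 2
    have m2 := ii_mono (show -ρ ≤ -(ρ / 2) by linarith)
      (ii_of i2 le_rfl (show -ρ ≤ -(ρ / 2) by linarith) (by linarith))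
      (j2.add (intervalIntegrable_const (c := 32 * etaE ρ ε ^ 4))) (fun z hz => by
        have h1 := tanh_far (ρ := ρ) hε (show ρ / 4 ≤ -(z - s) by linarith [hz.2])
        rw [neg_div, Real.tanh_neg] at h1
        have h2 := abs_le.1 (Q_sub_tanh hχ1 hρ hχr hχe hε (z - s))
        have h3 := (abs_le.1 (Q_abs_le hχr ε (z - s))).1
        have h4 : (1 + Qeps χ ε (z - s)) ^ 2 ≤ (4 * etaE ρ ε ^ 2) ^ 2 := by
          have : 0 ≤ 1 + Qeps χ ε (z - s) := by linarith
          gcongr; linarith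
        show (v z + 1) ^ 2 ≤ 2 * (v z - Qeps χ ε (z - s)) ^ 2 + 32 * etaE ρ ε ^ 4
        nlinarith [sq_nonneg ((v z - Qeps χ ε (z - s)) - (1 + Qeps χ ε (z - s)))])
    rw [intervalIntegral.integral_add j2 intervalIntegrable_const, intervalIntegral.integral_const_mul,
      intervalIntegral.integral_const, smul_eq_mul] at m2
    nlinarith

/-- Pointwise control of the derivative of the difference. -/
lemma Wd_facts {ρ K ε s : ℝ} {χ : ℝ → ℝ} (hε : 0 < ε) (hK : 0 < K)
    (hQ : ∀ z, ∃ d, HasDerivAt (Qeps χ ε) d z ∧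
      |d - (1 - Real.tanh (z / ε) ^ 2) / ε| ≤ K / ε * etaE ρ ε ^ 2) {v : ℝ → ℝ} (h : Adm ρ v) :
    (∀ z ∈ Set.Ioo (-ρ) ρ, |deriv (fun z => v z - Qeps χ ε (z - s)) z
      - (deriv v z - (1 - Real.tanh ((z - s) / ε) ^ 2) / ε)| ≤ K / ε * etaE ρ ε ^ 2) ∧
    IntegrableOn (fun z => deriv (fun z => v z - Qeps χ ε (z - s)) z ^ 2) (Set.Ioo (-ρ) ρ) := by
  have hp : ∀ z ∈ Set.Ioo (-ρ) ρ, |deriv (fun z => v z - Qeps χ ε (z - s)) z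
      - (deriv v z - (1 - Real.tanh ((z - s) / ε) ^ 2) / ε)| ≤ K / ε * etaE ρ ε ^ 2 := by
    intro z hz
    obtain ⟨d, hd, hd2⟩ := hQ (z - s)
    have h1 : HasDerivAt (fun z => v z - Qeps χ ε (z - s)) (deriv v z - d) z := by
      have h2 := hd.comp z ((hasDerivAt_id z).sub_const s)
      rw [mul_one] at h2
      exact (h.hasDeriv hz).sub h2
    rw [h1.deriv]
    rw [abs_sub_comm] at hd2
    have : deriv v z - d - (deriv v z - (1 - Real.tanh ((z - s) / ε) ^ 2) / ε)
      = (1 - Real.tanh ((z - s) / ε) ^ 2) / ε - d := by ring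
    rw [this]; exact hd2
  refine ⟨hp, ?_⟩
  refine Integrable.mono' (g := fun z => 2 * deriv v z ^ 2 + 2 * (1 / ε + K / ε * etaE ρ ε ^ 2) ^ 2)
    ((h.int_dsq.const_mul 2).add (integrable_const _))
    ((measurable_deriv _).pow_const 2).aestronglyMeasurable ?_
  refine (ae_restrict_iff' measurableSet_Ioo).2 (Filter.Eventually.of_forall fun z hz => ?_)
  rw [Real.norm_eq_abs, abs_of_nonneg (sq_nonneg _)]
  have h1 := abs_le.1 (hp z hz)
  set W := deriv (fun z => v z - Qeps χ ε (z - s)) z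
  have h2 : 0 ≤ (1 - Real.tanh ((z - s) / ε) ^ 2) / ε := div_nonneg (th_one_sub_sq_pos _).le hε.le
  have h3 : (1 - Real.tanh ((z - s) / ε) ^ 2) / ε ≤ 1 / ε := by
    gcongr; nlinarith [sq_nonneg (Real.tanh ((z - s) / ε))]
  have h4 : (W - deriv v z) ^ 2 ≤ (1 / ε + K / ε * etaE ρ ε ^ 2) ^ 2 :=
    sq_le_sq' (by linarith) (by linarith)
  nlinarith [sq_nonneg (W - 2 * deriv v z)]

lemma Wd_caseA {ρ K ε s T : ℝ} {χ : ℝ → ℝ} (hρ : 0 < ρ) (hε : 0 < ε) (hK : 0 < K)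
    (hχs : ContDiff ℝ (⊤ : ℕ∞) χ) (hχe : ∀ z, χ (-z) = χ z) (hχr : ∀ z, χ z ∈ Set.Icc (0 : ℝ) 1)
    (hχ1 : ∀ z, |z| ≤ ρ / 3 → χ z = 1)
    (hQ : ∀ z, ∃ d, HasDerivAt (Qeps χ ε) d z ∧
      |d - (1 - Real.tanh (z / ε) ^ 2) / ε| ≤ K / ε * etaE ρ ε ^ 2) {v : ℝ → ℝ} (h : Adm ρ v)
    (hv : ∀ z ∈ Set.Ioo (-ρ) ρ, |v z| ≤ 2)
    (hr : ∫ z in Set.Ioo (-ρ) ρ, rr ε v z ^ 2 ≤ 12 * ε * T) :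
    ε * (∫ z in Set.Ioo (-ρ) ρ, deriv (fun z => v z - Qeps χ ε (z - s)) z ^ 2)
      ≤ 48 * T + 72 * (ε⁻¹ * FQ ρ χ ε v s) + (576 + 4 * K ^ 2) * (ρ * etaE ρ ε ^ 4 / ε) := by
  obtain ⟨hp, hi⟩ := Wd_facts (s := s) hε hK hQ h
  have hF := FQ_int hρ hχs hχr hχ1 ε s h.memLp
  have key := int_le4 hρ (4 / ε ^ 2) (72 / ε ^ 2) 0 0 ((288 + 2 * K ^ 2) * etaE ρ ε ^ 4 / ε ^ 2)
    hi (h.int_rr hρ ε) hF hF hF (by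
      intro z hz
      have h1 := hp z hz
      set W := deriv (fun z => v z - Qeps χ ε (z - s)) z
      have h2 := Q_sub_tanh hχ1 hρ hχr hχe hε (z - s)
      have h3 := hv z hz
      set q := Real.tanh ((z - s) / ε)
      have hq : |q| ≤ 1 := (Real.abs_tanh_lt_one _).le
      set Q := Qeps χ ε (z - s)
      set η := etaE ρ ε
      have hη : 0 < η := etaE_pos ρ ε
      have e1 : ε * (deriv v z - (1 - q ^ 2) / ε) = rr ε v z - (v z + q) * (v z - q) := by
        unfold rr; field_simp; ring
      have f1 : |ε * W - (rr ε v z - (v z + q) * (v z - q))| ≤ K * η ^ 2 := by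
        rw [← e1, ← mul_sub, abs_mul, abs_of_pos hε]
        calc ε * |W - (deriv v z - (1 - q ^ 2) / ε)| ≤ ε * (K / ε * η ^ 2) := by gcongr
          _ = K * η ^ 2 := by field_simp
      have f2 : (ε * W - (rr ε v z - (v z + q) * (v z - q))) ^ 2 ≤ (K * η ^ 2) ^ 2 := by
        rw [← sq_abs]; gcongr
      have f3 : (v z + q) ^ 2 ≤ 9 := by
        have h5 : |v z + q| ≤ 3 := (abs_add_le _ _).trans (by linarith)
        rw [← sq_abs]; nlinarith [abs_nonneg (v z + q)]
      have f4 : (Q - q) ^ 2 ≤ (2 * η ^ 2) ^ 2 := by rw [← sq_abs]; gcongr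
      have f5 : (v z - q) ^ 2 ≤ 2 * (v z - Q) ^ 2 + 8 * η ^ 4 := by
        nlinarith [sq_nonneg ((v z - Q) - (Q - q))]
      have f6 : ((v z + q) * (v z - q)) ^ 2 ≤ 9 * (v z - q) ^ 2 := by
        rw [mul_pow]; exact mul_le_mul_of_nonneg_right f3 (sq_nonneg _)
      have f7 : (rr ε v z - (v z + q) * (v z - q)) ^ 2 ≤ 2 * rr ε v z ^ 2 + 2 * ((v z + q) * (v z - q)) ^ 2 := by
        nlinarith [sq_nonneg (rr ε v z + (v z + q) * (v z - q))]
      have f8 : (ε * W) ^ 2 ≤ 2 * (rr ε v z - (v z + q) * (v z - q)) ^ 2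
          + 2 * (ε * W - (rr ε v z - (v z + q) * (v z - q))) ^ 2 := by
        nlinarith [sq_nonneg ((rr ε v z - (v z + q) * (v z - q)) - (ε * W - (rr ε v z - (v z + q) * (v z - q))))]
      have f9 : (ε * W) ^ 2 ≤ 4 * rr ε v z ^ 2 + 72 * (v z - Q) ^ 2 + (288 + 2 * K ^ 2) * η ^ 4 := by
        nlinarith
      have e2 : W ^ 2 = (ε * W) ^ 2 / ε ^ 2 := by field_simp
      have e3 : 4 / ε ^ 2 * rr ε v z ^ 2 + 72 / ε ^ 2 * (v z - Q) ^ 2 + 0 * (v z - Q) ^ 2 + 0 * (v z - Q) ^ 2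
          + (288 + 2 * K ^ 2) * η ^ 4 / ε ^ 2
          = (4 * rr ε v z ^ 2 + 72 * (v z - Q) ^ 2 + (288 + 2 * K ^ 2) * η ^ 4) / ε ^ 2 := by field_simp; ring
      rw [e2, e3]
      gcongr)
  have k2 := mul_le_mul_of_nonneg_left key hε.le
  refine k2.trans ?_
  have e : ε * (4 / ε ^ 2 * (∫ z in Set.Ioo (-ρ) ρ, rr ε v z ^ 2)
      + 72 / ε ^ 2 * (∫ z in Set.Ioo (-ρ) ρ, (v z - Qeps χ ε (z - s)) ^ 2)
      + 0 * (∫ z in Set.Ioo (-ρ) ρ, (v z - Qeps χ ε (z - s)) ^ 2)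
      + 0 * (∫ z in Set.Ioo (-ρ) ρ, (v z - Qeps χ ε (z - s)) ^ 2)
      + (288 + 2 * K ^ 2) * etaE ρ ε ^ 4 / ε ^ 2 * (2 * ρ))
      = 4 / ε * (∫ z in Set.Ioo (-ρ) ρ, rr ε v z ^ 2) + 72 * (ε⁻¹ * FQ ρ χ ε v s)
        + (576 + 4 * K ^ 2) * (ρ * etaE ρ ε ^ 4 / ε) := by
    unfold FQ; field_simp; ring
  rw [e]
  have : 4 / ε * (∫ z in Set.Ioo (-ρ) ρ, rr ε v z ^ 2) ≤ 4 / ε * (12 * ε * T) := by gcongr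
  have e2 : 4 / ε * (12 * ε * T) = 48 * T := by field_simp; ring
  linarith

lemma Wd_caseB {ρ K ε s : ℝ} {χ : ℝ → ℝ} (hρ : 0 < ρ) (hε : 0 < ε) (hK : 0 < K)
    (hQ : ∀ z, ∃ d, HasDerivAt (Qeps χ ε) d z ∧
      |d - (1 - Real.tanh (z / ε) ^ 2) / ε| ≤ K / ε * etaE ρ ε ^ 2) {v : ℝ → ℝ} (h : Adm ρ v) :
    ε * (∫ z in Set.Ioo (-ρ) ρ, deriv (fun z => v z - Qeps χ ε (z - s)) z ^ 2)
      ≤ 4 * (theta1 ρ ε v + 4 / 3) + 8 + 8 * K ^ 2 * (ρ * etaE ρ ε ^ 4 / ε) := by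
  obtain ⟨hp, hi⟩ := Wd_facts (s := s) hε hK hQ h
  have hS : IntegrableOn (fun z => 1 - Real.tanh ((z - s) / ε) ^ 2) (Set.Ioo (-ρ) ρ) :=
    (integrable_const _).sub (tq_memLp ρ ε s).integrable_sq
  have he := h.int_en hρ ε
  have key := int_le4 hρ (4 / ε) (4 / ε ^ 2) 0 0 (4 * K ^ 2 * etaE ρ ε ^ 4 / ε ^ 2)
    hi he hS hS hS (by
      intro z hz
      have h1 := hp z hz
      set W := deriv (fun z => v z - Qeps χ ε (z - s)) z
      have hq0 := th_one_sub_sq_pos ((z - s) / ε)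
      set q := Real.tanh ((z - s) / ε)
      set η := etaE ρ ε
      have hη : 0 < η := etaE_pos ρ ε
      have f1 : |ε * W - (ε * deriv v z - (1 - q ^ 2))| ≤ K * η ^ 2 := by
        have e1 : ε * W - (ε * deriv v z - (1 - q ^ 2)) = ε * (W - (deriv v z - (1 - q ^ 2) / ε)) := by
          field_simp
        rw [e1, abs_mul, abs_of_pos hε]
        calc ε * |W - (deriv v z - (1 - q ^ 2) / ε)| ≤ ε * (K / ε * η ^ 2) := by gcongr
          _ = K * η ^ 2 := by field_simp
      have f2 : (ε * W - (ε * deriv v z - (1 - q ^ 2))) ^ 2 ≤ (K * η ^ 2) ^ 2 := by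
        rw [← sq_abs]; gcongr
      have f3 : (1 - q ^ 2) ^ 2 ≤ 1 - q ^ 2 := by nlinarith [sq_nonneg q]
      have f4 : ε ^ 2 * deriv v z ^ 2 ≤ 2 * ε * en ε v z := by
        have : 2 * ε * en ε v z = ε ^ 2 * deriv v z ^ 2 + (v z ^ 2 - 1) ^ 2 := by
          unfold en; field_simp
        nlinarith [sq_nonneg (v z ^ 2 - 1)]
      set D := ε * W - (ε * deriv v z - (1 - q ^ 2)) with hD
      have f5 : (ε * W) ^ 2 ≤ 2 * (ε * deriv v z) ^ 2 + 4 * (1 - q ^ 2) ^ 2 + 4 * D ^ 2 := by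
        have : ε * W = ε * deriv v z + (D - (1 - q ^ 2)) := by rw [hD]; ring
        rw [this]
        nlinarith [sq_nonneg (ε * deriv v z - (D - (1 - q ^ 2))), sq_nonneg (D + (1 - q ^ 2))]
      have f9 : (ε * W) ^ 2 ≤ 4 * ε * en ε v z + 4 * (1 - q ^ 2) + 4 * K ^ 2 * η ^ 4 := by
        nlinarith
      have e2 : W ^ 2 = (ε * W) ^ 2 / ε ^ 2 := by field_simp
      have e3 : 4 / ε * en ε v z + 4 / ε ^ 2 * (1 - q ^ 2) + 0 * (1 - q ^ 2) + 0 * (1 - q ^ 2)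
          + 4 * K ^ 2 * η ^ 4 / ε ^ 2
          = (4 * ε * en ε v z + 4 * (1 - q ^ 2) + 4 * K ^ 2 * η ^ 4) / ε ^ 2 := by field_simp; ring
      rw [e2, e3]
      gcongr)
  have k2 := mul_le_mul_of_nonneg_left key hε.le
  refine k2.trans ?_
  have hen : ∫ z in Set.Ioo (-ρ) ρ, en ε v z ≤ theta1 ρ ε v + 4 / 3 := by
    rw [theta1_eq hρ h]
    have : ∫ z in (-ρ)..ρ, en ε v z = ∫ z in Set.Ioo (-ρ) ρ, en ε v z := by
      rw [intervalIntegral.integral_of_le (by linarith), integral_Ioc_eq_integral_Ioo]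
    rw [this]
    have n1 : 0 ≤ ∫ z in (-ρ)..ρ, z ^ 2 * en ε v z :=
      intervalIntegral.integral_nonneg (by linarith) fun z _ => mul_nonneg (sq_nonneg z) (en_nonneg hε v z)
    linarith
  have hse := int_sech hρ hε s
  set E := ∫ z in Set.Ioo (-ρ) ρ, en ε v z
  set S := ∫ z in Set.Ioo (-ρ) ρ, (1 - Real.tanh ((z - s) / ε) ^ 2)
  have e : ε * (4 / ε * E + 4 / ε ^ 2 * S + 0 * S + 0 * S + 4 * K ^ 2 * etaE ρ ε ^ 4 / ε ^ 2 * (2 * ρ))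
      = 4 * E + 4 / ε * S + 8 * K ^ 2 * (ρ * etaE ρ ε ^ 4 / ε) := by
    field_simp; ring
  rw [e]
  have g1 : 4 / ε * S ≤ 4 / ε * (2 * ε) := by gcongr
  have g2 : 4 / ε * (2 * ε) = 8 := by field_simp; norm_num
  linarith

set_option maxHeartbeats 2000000 in
/-- There exist `0 < c₁, c₂`, `0 < c₃ < 1`, `C > 0`, `c > 0` and `ε₀ > 0`
such that for every `ε ∈ (0, ε₀)` and every `v ∈ H¹(I)`, if either
(`θ₁(v) ≤ c₁` and `θ₂(v) ≤ c₂`) or `inf_{|s| ≤ c₃ρ} ‖v − τ_s Q_ε‖_{L²(I)} < c₃√ε`, then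
`s ↦ ‖v − τ_s Q_ε‖_{L²(I)}` has a unique global minimizer `s*`, which satisfies
`s*² ≤ C(ε² + θ₁(v))` and `‖v − τ_{s*}Q_ε‖²_{H¹_ε(I)} ≤ C(θ₁(v) + e^{−c/ε})`, where
`‖w‖²_{H¹_ε(I)} = ε⁻¹‖w‖²_{L²(I)} + ε‖w′‖²_{L²(I)}`. -/
theorem coercivity_of_theta1
    (ρ : ℝ) (hρ : 0 < ρ) (χ : ℝ → ℝ)
    (hχs : ContDiff ℝ (⊤ : ℕ∞) χ)
    (hχe : ∀ z, χ (-z) = χ z)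
    (hχr : ∀ z, χ z ∈ Set.Icc (0 : ℝ) 1)
    (hχ1 : ∀ z, |z| ≤ ρ / 3 → χ z = 1)
    (hχ0 : ∀ z, 2 * ρ / 3 ≤ |z| → χ z = 0)
    (hχm : ∀ z, z * deriv χ z ≤ 0) :
    ∃ c₁ > 0, ∃ c₂ > 0, ∃ c₃ ∈ Set.Ioo (0 : ℝ) 1, ∃ C > 0, ∃ c > 0, ∃ ε₀ > 0,
      ∀ ε : ℝ, 0 < ε → ε < ε₀ →
      ∀ v : ℝ → ℝ,
        DifferentiableOn ℝ v (Set.Ioo (-ρ) ρ) →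
        IntegrableOn (fun z => (v z) ^ 2 + (deriv v z) ^ 2) (Set.Ioo (-ρ) ρ) →
        ((theta1 ρ ε v ≤ c₁ ∧ theta2 ρ v ≤ c₂) ∨
          (∃ s : ℝ, |s| ≤ c₃ * ρ ∧ L2distQ ρ χ ε v s < c₃ * Real.sqrt ε)) →
        ∃ s : ℝ,
          (∀ σ : ℝ, L2distQ ρ χ ε v s ≤ L2distQ ρ χ ε v σ) ∧
          (∀ s' : ℝ, (∀ σ : ℝ, L2distQ ρ χ ε v s' ≤ L2distQ ρ χ ε v σ) → s' = s) ∧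
          s ^ 2 ≤ C * (ε ^ 2 + theta1 ρ ε v) ∧
          (ε⁻¹ * (∫ z in Set.Ioo (-ρ) ρ, (v z - Qeps χ ε (z - s)) ^ 2)
              + ε * (∫ z in Set.Ioo (-ρ) ρ,
                  (deriv (fun z => v z - Qeps χ ε (z - s)) z) ^ 2))
            ≤ C * (theta1 ρ ε v + Real.exp (-c / ε)) := by
  obtain ⟨K, hK, hQd⟩ := Q_deriv hρ hχs hχe hχr hχ1 hχ0
  obtain ⟨K₁, hK₁, hU⟩ := FQ_unique hρ hχs hχe hχr hχ1 hχ0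
  set κ : ℝ := min ((1 / 4000) ^ 2 / 288) (ρ ^ 2 / 64) with hκdef
  have hκ : 0 < κ := by positivity
  have hκ1 : κ ≤ (1 / 4000) ^ 2 / 288 := min_le_left _ _
  have hκ2 : κ ≤ ρ ^ 2 / 64 := min_le_right _ _
  set A : ℝ := min (ρ / 12) (min ((1 / 4000) ^ 2 / (64 * ρ)) (min (1 / (4 * K₁ ^ 2 * ρ)) (min (1 / ρ)
    (min (κ / 2) (min (3 * ρ ^ 3 / 64) (3 * ρ / 16)))))) with hA
  obtain ⟨ε₀, hε₀, hsm⟩ := eps_small (A := A) hρ (by positivity)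
  set C : ℝ := 20000 + 4 * K ^ 2 + (ρ ^ 2 + 16 + 8 * K ^ 2) / (κ / 2) with hC
  have hC1 : 0 ≤ (ρ ^ 2 + 16 + 8 * K ^ 2) / (κ / 2) := by positivity
  refine ⟨κ / 2, by positivity, ρ ^ 2 / 800, by positivity, 1 / 4000, ⟨by norm_num, by norm_num⟩, C,
    by positivity, ρ / 4, by positivity, ε₀, hε₀, ?_⟩
  intro ε hε hεε v hv1 hv2 hyp
  have hadm : Adm ρ v := ⟨hv1, hv2⟩
  obtain ⟨hεA, hε1, hη2⟩ := hsm ε hε hεε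
  rw [hA] at hεA
  simp only [le_min_iff] at hεA
  obtain ⟨b1, b2, b3, b4, b5, b6, b7⟩ := hεA
  have hηdef : Real.exp (-(ρ / 4) / ε) = etaE ρ ε := rfl
  rw [hηdef]
  have hη0 : 0 < etaE ρ ε := etaE_pos ρ ε
  set η := etaE ρ ε with hηd
  have hεsq : ε ^ 2 ≤ ε := by rw [sq]; exact mul_le_of_le_one_left hε.le hε1
  have hηε : η ≤ ε := hη2.trans hεsq
  have hη1 : η ≤ 1 := by linarith
  have hη3 : η ^ 3 ≤ ε ^ 2 := by
    calc η ^ 3 = η * η ^ 2 := by ring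
      _ ≤ ε ^ 2 * 1 := by gcongr; exact pow_le_one₀ hη0.le hη1
      _ = ε ^ 2 := by ring
  have hη4 : η ^ 4 ≤ ε ^ 2 := by
    calc η ^ 4 = η * η ^ 3 := by ring
      _ ≤ 1 * ε ^ 2 := by gcongr
      _ = ε ^ 2 := by ring
  have s1 : 64 * ρ * η ^ 4 ≤ (1 / 4000) ^ 2 * ε := by
    rw [le_div_iff₀ (by positivity)] at b2
    calc 64 * ρ * η ^ 4 ≤ 64 * ρ * ε ^ 2 := by gcongr
      _ = (ε * (64 * ρ)) * ε := by ring
      _ ≤ (1 / 4000) ^ 2 * ε := by gcongr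
  have s2 : 4 * K₁ ^ 2 * ρ * η ^ 4 ≤ ε := by
    rw [le_div_iff₀ (by positivity)] at b3
    calc 4 * K₁ ^ 2 * ρ * η ^ 4 ≤ 4 * K₁ ^ 2 * ρ * ε ^ 2 := by gcongr
      _ = (ε * (4 * K₁ ^ 2 * ρ)) * ε := by ring
      _ ≤ 1 * ε := by gcongr
      _ = ε := one_mul ε
  have s3 : ρ * η ^ 4 / ε ≤ η := by
    rw [le_div_iff₀ hρ] at b4
    rw [div_le_iff₀ hε]
    calc ρ * η ^ 4 = η * (ρ * η ^ 3) := by ring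
      _ ≤ η * (ρ * ε ^ 2) := by gcongr
      _ = η * ((ε * ρ) * ε) := by ring
      _ ≤ η * (1 * ε) := by gcongr
      _ = η * ε := by ring
  have s4 : η ≤ κ / 2 := by linarith
  have s5 : 8 * ε / (3 * ρ) ≤ ρ ^ 2 / 8 := by
    rw [div_le_iff₀ (by positivity)]; linarith
  have s6 : 8 * ε / (3 * ρ) ≤ 1 / 2 := by
    rw [div_le_iff₀ (by positivity)]; linarith
  -- the second option in terms of squares
  have hyp' : (theta1 ρ ε v ≤ κ / 2 ∧ theta2 ρ v ≤ ρ ^ 2 / 800) ∨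
      ∃ s, |s| ≤ ρ / 4 ∧ FQ ρ χ ε v s ≤ (1 / 4000) ^ 2 * ε := by
    rcases hyp with hy | ⟨s, hs, hL⟩
    · exact Or.inl hy
    · refine Or.inr ⟨s, by linarith, ?_⟩
      have h1 : L2distQ ρ χ ε v s ^ 2 = FQ ρ χ ε v s := Real.sq_sqrt (FQ_nonneg ρ χ ε v s)
      have h0 : 0 ≤ L2distQ ρ χ ε v s := Real.sqrt_nonneg _
      rw [← h1]
      calc L2distQ ρ χ ε v s ^ 2 ≤ (1 / 4000 * Real.sqrt ε) ^ 2 := by gcongr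
        _ = (1 / 4000) ^ 2 * ε := by rw [mul_pow, Real.sq_sqrt hε.le]
  have hUv := hU ε hε hε1 b1 s1 s2 v hadm.memLp
  simp only [L2_le_iff]
  by_cases hθ : theta1 ρ ε v ≤ κ / 2
  · -- small energy
    have hends : ∫ z in (ρ / 2)..ρ, (v z - 1) ^ 2 ≤ ρ / 400 ∧
        ∫ z in (-ρ)..(-(ρ / 2)), (v z + 1) ^ 2 ≤ ρ / 400 := by
      rcases hyp' with hy | ⟨s, hs, hF⟩
      · exact theta2_right hadm hρ hy.2
      · exact close_right hρ hχs hχe hχr hχ1 hε b1 s1 hadm hs hF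
    have hθ0 := hadm.theta1_nonneg hρ hε s5 s6 hends.1 hends.2
    obtain ⟨s₀, hs0, hs02, hvb, hw, hr⟩ := hadm.energy (T := theta1 ρ ε v + η) hρ hε s5 s6 hends.1 hends.2
      (by linarith) (by linarith) (by linarith)
    have hF0 : FQ ρ χ ε v s₀ ≤ 144 * ε * (theta1 ρ ε v + η) + 32 * ρ * η ^ 4 := by
      have hi := FQ_int hρ hχs hχr hχ1 ε s₀ hadm.memLp
      have hwi : IntegrableOn (fun z => (v z - Real.tanh ((z - s₀) / ε)) ^ 2) (Set.Ioo (-ρ) ρ) :=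
        (hadm.memLp.sub (tq_memLp ρ ε s₀)).integrable_sq
      have key := int_le4 hρ 2 0 0 0 (8 * η ^ 4) hi hwi hwi hwi hwi (fun z _ => by
        have h2 := Q_sub_tanh hχ1 hρ hχr hχe hε (z - s₀)
        have f4 : (Qeps χ ε (z - s₀) - Real.tanh ((z - s₀) / ε)) ^ 2 ≤ (2 * η ^ 2) ^ 2 := by
          rw [← sq_abs]; gcongr
        nlinarith [sq_nonneg ((v z - Real.tanh ((z - s₀) / ε)) + (Qeps χ ε (z - s₀) - Real.tanh ((z - s₀) / ε)))])
      have : FQ ρ χ ε v s₀ = ∫ z in Set.Ioo (-ρ) ρ, (v z - Qeps χ ε (z - s₀)) ^ 2 := rfl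
      rw [this]
      linarith
    have hF1 : FQ ρ χ ε v s₀ ≤ (1 / 4000) ^ 2 * ε := by
      have h1 : 144 * ε * (theta1 ρ ε v + η) ≤ 144 * ε * ((1 / 4000) ^ 2 / 288) := by
        gcongr; linarith
      linarith
    obtain ⟨s, hmin, huniq, hcl⟩ := hUv s₀ hs0 hF1
    refine ⟨s, hmin, huniq, ?_, ?_⟩
    · have h1 : (s - s₀) ^ 2 ≤ ε ^ 2 := by rw [← sq_abs]; gcongr
      have h2 : s ^ 2 ≤ 2 * (s - s₀) ^ 2 + 2 * s₀ ^ 2 := by nlinarith [sq_nonneg (s - 2 * s₀)]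
      have h3 : s ^ 2 ≤ 10 * (ε ^ 2 + theta1 ρ ε v) := by linarith
      refine h3.trans ?_
      have h4 : 0 ≤ ε ^ 2 + theta1 ρ ε v := by positivity
      have h5 : 10 ≤ C := by rw [hC]; linarith [sq_nonneg K]
      gcongr
    · have hW := Wd_caseA (s := s) hρ hε hK hχs hχe hχr hχ1 (hQd ε hε hε1) hadm hvb hr
      have hFs : ε⁻¹ * FQ ρ χ ε v s ≤ 144 * (theta1 ρ ε v + η) + 32 * η := by
        have h1 : ε⁻¹ * FQ ρ χ ε v s ≤ ε⁻¹ * (144 * ε * (theta1 ρ ε v + η) + 32 * ρ * η ^ 4) := by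
          have := (hmin s₀).trans hF0
          gcongr
        have h2 : ε⁻¹ * (144 * ε * (theta1 ρ ε v + η) + 32 * ρ * η ^ 4)
            = 144 * (theta1 ρ ε v + η) + 32 * (ρ * η ^ 4 / ε) := by field_simp
        linarith
      have hW2 : (576 + 4 * K ^ 2) * (ρ * etaE ρ ε ^ 4 / ε) ≤ (576 + 4 * K ^ 2) * η := by
        gcongr
      have hKη : 0 ≤ K ^ 2 * theta1 ρ ε v := by positivity
      have hC3 : C * (theta1 ρ ε v + η) = (20000 + 4 * K ^ 2) * (theta1 ρ ε v + η)
        + (ρ ^ 2 + 16 + 8 * K ^ 2) / (κ / 2) * (theta1 ρ ε v + η) := by rw [hC]; ring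
      have hC4 : 0 ≤ (ρ ^ 2 + 16 + 8 * K ^ 2) / (κ / 2) * (theta1 ρ ε v + η) :=
        mul_nonneg hC1 (by linarith)
      have hFd : FQ ρ χ ε v s = ∫ z in Set.Ioo (-ρ) ρ, (v z - Qeps χ ε (z - s)) ^ 2 := rfl
      rw [← hFd, hC3]
      linarith
  · -- large energy
    rcases hyp' with hy | ⟨s₁, hs1, hF⟩
    · exact absurd hy.1 hθ
    push Not at hθ
    obtain ⟨s, hmin, huniq, hcl⟩ := hUv s₁ hs1 hF
    have hbig : ∀ x : ℝ, 0 ≤ x → x ≤ x / (κ / 2) * theta1 ρ ε v := by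
      intro x hx
      have h1 : x / (κ / 2) * (κ / 2) ≤ x / (κ / 2) * theta1 ρ ε v := by gcongr
      have h2 : x / (κ / 2) * (κ / 2) = x := by field_simp
      linarith
    have hθ0 : 0 < theta1 ρ ε v := by linarith
    refine ⟨s, hmin, huniq, ?_, ?_⟩
    · have h1 := abs_le.1 hcl
      have h2 := abs_le.1 hs1
      have h3 : s ^ 2 ≤ ρ ^ 2 := sq_le_sq' (by linarith) (by linarith)
      have h4 := hbig (ρ ^ 2 + 16 + 8 * K ^ 2) (by positivity)
      have h5 : 0 ≤ C * ε ^ 2 := by positivity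
      have h6 : 0 ≤ (20000 + 4 * K ^ 2) * theta1 ρ ε v := by positivity
      have hC3 : C * (ε ^ 2 + theta1 ρ ε v) = C * ε ^ 2 + (20000 + 4 * K ^ 2) * theta1 ρ ε v
        + (ρ ^ 2 + 16 + 8 * K ^ 2) / (κ / 2) * theta1 ρ ε v := by rw [hC]; ring
      rw [hC3]
      linarith [sq_nonneg K]
    · have hW := Wd_caseB (s := s) hρ hε hK (hQd ε hε hε1) hadm
      have hFs : ε⁻¹ * FQ ρ χ ε v s ≤ (1 / 4000) ^ 2 := by
        have h1 : ε⁻¹ * FQ ρ χ ε v s ≤ ε⁻¹ * ((1 / 4000) ^ 2 * ε) := by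
          have := (hmin s₁).trans hF
          gcongr
        have h2 : ε⁻¹ * ((1 / 4000) ^ 2 * ε) = (1 / 4000) ^ 2 := by field_simp
        linarith
      have hW2 : 8 * K ^ 2 * (ρ * etaE ρ ε ^ 4 / ε) ≤ 8 * K ^ 2 * 1 := by
        have := s3.trans hη1
        gcongr
      have h4 := hbig (ρ ^ 2 + 16 + 8 * K ^ 2) (by positivity)
      have h5 : 0 ≤ C * η := by positivity
      have h6 : 0 ≤ K ^ 2 * theta1 ρ ε v := by positivity
      have hC3 : C * (theta1 ρ ε v + η) = C * η + (20000 + 4 * K ^ 2) * theta1 ρ ε v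
        + (ρ ^ 2 + 16 + 8 * K ^ 2) / (κ / 2) * theta1 ρ ε v := by rw [hC]; ring
      have hFd : FQ ρ χ ε v s = ∫ z in Set.Ioo (-ρ) ρ, (v z - Qeps χ ε (z - s)) ^ 2 := rfl
      rw [← hFd, hC3]
      linarith [sq_nonneg ρ]
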